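/- arXiv:1404.5554 — 3 statements merged into one kernel-verified Lean document; each statement's English description precedes it below -/
import Mathlib

section
/- Consider the Markov-modulated alternating service model with exponential preparation times: M ≥ 1, P = (p_{i,j}) an irreducible M×M stochastic matrix with stationary distribution ϖ, rates μ_1,…,μ_M > 0, service-time laws ν_i on [0,∞) with Laplace–Stieltjes transforms α_i. Suppose (W, Z, Z', A, B) are as in the stationary setting: conditionally on (W, Z = i), Z' = j with probability p_{i,j}; conditionally on Z = i, A ~ ν_i independent of (W, Z'); conditionally on Z' = j, B ~ Exp(μ_j) independent of (W, Z, A); and (max(0, B − A − W), Z') has the same law as (W, Z). Then the M² quantities ω_j(μ_ℓ) := E[e^{−μ_ℓ W} 1_{Z=j}] satisfy the linear system: for all j, ℓ ∈ {1,…,M}, ω_j(μ_ℓ) = ϖ_j − (μ_ℓ/(μ_j + μ_ℓ)) · Σ_{i=1}^M p_{i,j} ω_i(μ_j) α_i(μ_j). -/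
open MeasureTheory ProbabilityTheory

lemma expMeasure_Iic {m : ℝ} (hm : 0 < m) (x : ℝ) :
    expMeasure m (Set.Iic x) = ENNReal.ofReal (1 - Real.exp (-m * x)) := by
  have := isProbabilityMeasure_expMeasure hm
  rw [← ofReal_cdf, cdf_expMeasure_eq hm]
  split_ifs with h
  · rw [neg_mul]
  · rw [ENNReal.ofReal_zero, eq_comm, ENNReal.ofReal_eq_zero, sub_nonpos, Real.one_le_exp_iff]
    nlinarith

lemma setIntegral_Ioi_exp_expMeasure {m s y : ℝ} (hm : 0 < m) (hs : 0 < s) (hy : 0 ≤ y) :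
    ∫ b in Set.Ioi y, Real.exp (-s * (b - y)) ∂expMeasure m
      = m / (m + s) * Real.exp (-m * y) := by
  have hd : expMeasure m = volume.withDensity (exponentialPDF m) := rfl
  have hmeas : Measurable (exponentialPDF m) :=
    (measurable_exponentialPDFReal m).ennreal_ofReal
  rw [hd, setIntegral_withDensity_eq_setIntegral_toReal_smul hmeas
    (ae_of_all _ fun _ => ENNReal.ofReal_lt_top) _ measurableSet_Ioi]
  have h : ∀ b ∈ Set.Ioi y, (exponentialPDF m b).toReal • Real.exp (-s * (b - y))
      = m * Real.exp (s * y) * Real.exp (-(m + s) * b) := by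
    intro b hb
    have hb0 : 0 ≤ b := hy.trans (le_of_lt hb)
    rw [exponentialPDF_of_nonneg hb0, ENNReal.toReal_ofReal (by positivity), smul_eq_mul,
      mul_assoc, mul_assoc, ← Real.exp_add, ← Real.exp_add]
    ring_nf
  rw [setIntegral_congr_fun measurableSet_Ioi h, integral_const_mul,
    integral_exp_mul_Ioi (by linarith), neg_div_neg_eq]
  have h2 : Real.exp (-m * y) = Real.exp (s * y) * Real.exp (-(m + s) * y) := by
    rw [← Real.exp_add]
    ring_nf
  rw [h2]
  ring

lemma integrable_exp_neg_mul {X : Type*} [MeasurableSpace X] (P : Measure X) [IsFiniteMeasure P]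
    {s : ℝ} (hs : 0 ≤ s) {f : X → ℝ} (hf : Measurable f) (h0 : ∀ᵐ x ∂P, 0 ≤ f x) :
    Integrable (fun x => Real.exp (-s * f x)) P := by
  refine Integrable.of_bound (by fun_prop) 1 ?_
  filter_upwards [h0] with x hx
  rw [Real.norm_eq_abs, Real.abs_exp, Real.exp_le_one_iff]
  nlinarith [mul_nonneg hs hx]

/-- The Laplace transform of the positive part of `B - y`, for `B` exponential of rate `m`. -/
lemma integral_exp_neg_mul_max_expMeasure {m s y : ℝ} (hm : 0 < m) (hs : 0 < s) (hy : 0 ≤ y) :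
    ∫ b, Real.exp (-s * max 0 (b - y)) ∂expMeasure m
      = 1 - s / (m + s) * Real.exp (-m * y) := by
  have := isProbabilityMeasure_expMeasure hm
  have hint : Integrable (fun b => Real.exp (-s * max 0 (b - y))) (expMeasure m) :=
    integrable_exp_neg_mul _ hs.le (by fun_prop) (ae_of_all _ fun _ => le_max_left _ _)
  have h1 : ∀ b ∈ Set.Iic y, Real.exp (-s * max 0 (b - y)) = 1 := fun b hb => by
    rw [max_eq_left (sub_nonpos.2 hb), mul_zero, Real.exp_zero]
  have h2 : ∀ b ∈ Set.Ioi y, Real.exp (-s * max 0 (b - y)) = Real.exp (-s * (b - y)) :=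
    fun b hb => by rw [max_eq_right (sub_nonneg.2 (le_of_lt hb))]
  rw [← integral_add_compl measurableSet_Iic hint, Set.compl_Iic,
    setIntegral_congr_fun measurableSet_Iic h1, setIntegral_congr_fun measurableSet_Ioi h2,
    setIntegral_Ioi_exp_expMeasure hm hs hy, setIntegral_const, smul_eq_mul, mul_one,
    measureReal_def, expMeasure_Iic hm, ENNReal.toReal_ofReal]
  · have : m + s ≠ 0 := by positivity
    field_simp
    ring
  · rw [sub_nonneg, Real.exp_le_one_iff]
    nlinarith [mul_nonneg hm.le hy]

lemma integral_exp_neg_mul_max_prod {m s : ℝ} (hm : 0 < m) (hs : 0 < s)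
    (κ ν : Measure ℝ) [IsFiniteMeasure κ] [IsProbabilityMeasure ν]
    (hκ : ∀ᵐ w ∂κ, 0 ≤ w) (hν : ∀ᵐ a ∂ν, 0 ≤ a) :
    ∫ q, Real.exp (-s * max 0 (q.2.2 - q.2.1 - q.1)) ∂(κ.prod (ν.prod (expMeasure m)))
      = κ.real Set.univ
        - s / (m + s) * ((∫ w, Real.exp (-m * w) ∂κ) * ∫ a, Real.exp (-m * a) ∂ν) := by
  have := isProbabilityMeasure_expMeasure hm
  rw [integral_prod _ (integrable_exp_neg_mul _ hs.le (by fun_prop)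
    (ae_of_all _ fun _ => le_max_left _ _))]
  have hκint : Integrable (fun w => Real.exp (-m * w)) κ :=
    integrable_exp_neg_mul _ hm.le measurable_id hκ
  have hνint : Integrable (fun a => Real.exp (-m * a)) ν :=
    integrable_exp_neg_mul _ hm.le measurable_id hν
  have h : ∀ᵐ w ∂κ, ∫ r, Real.exp (-s * max 0 (r.2 - r.1 - w)) ∂(ν.prod (expMeasure m))
      = 1 - s / (m + s) * (∫ a, Real.exp (-m * a) ∂ν) * Real.exp (-m * w) := by
    filter_upwards [hκ] with w hw
    rw [integral_prod _ (integrable_exp_neg_mul _ hs.le (by fun_prop)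
      (ae_of_all _ fun _ => le_max_left _ _))]
    have h' : ∀ᵐ a ∂ν, ∫ b, Real.exp (-s * max 0 (b - a - w)) ∂expMeasure m
        = 1 - s / (m + s) * Real.exp (-m * w) * Real.exp (-m * a) := by
      filter_upwards [hν] with a ha
      simp_rw [sub_sub]
      rw [integral_exp_neg_mul_max_expMeasure hm hs (add_nonneg ha hw), mul_assoc,
        ← Real.exp_add]
      ring_nf
    rw [integral_congr_ae h', integral_sub (integrable_const _) (hνint.const_mul _),
      integral_const_mul, integral_const, probReal_univ, one_smul]
    ring
  rw [integral_congr_ae h, integral_sub (integrable_const _) (hκint.const_mul _),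
    integral_const_mul, integral_const, smul_eq_mul, mul_one]
  ring

/-- An irreducible nonnegative matrix has at most one normalized nonnegative
left-invariant vector. -/
lemma eq_of_vecMul_eq_of_irreducible {ι : Type*} [Fintype ι] [DecidableEq ι] [Nonempty ι]
    (Q : Matrix ι ι ℝ) (hQ : ∀ i j, 0 ≤ Q i j)
    (h_irred : ∀ i j, ∃ n : ℕ, 0 < n ∧ 0 < (Q ^ n) i j)
    (u v : ι → ℝ) (hv0 : ∀ i, 0 ≤ v i) (hu1 : ∑ i, u i = 1) (hv1 : ∑ i, v i = 1)
    (hu : Matrix.vecMul u Q = u) (hv : Matrix.vecMul v Q = v) : u = v := by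
  have hpow : ∀ n i j, 0 ≤ (Q ^ n) i j := by
    intro n
    induction n with
    | zero =>
      intro i j
      rw [pow_zero, Matrix.one_apply]
      split_ifs <;> norm_num
    | succ n ih =>
      intro i j
      rw [pow_succ, Matrix.mul_apply]
      exact Finset.sum_nonneg fun k _ => mul_nonneg (ih i k) (hQ k j)
  have hinv : ∀ w : ι → ℝ, Matrix.vecMul w Q = w → ∀ n, Matrix.vecMul w (Q ^ n) = w := by
    intro w hw n
    induction n with
    | zero => rw [pow_zero, Matrix.vecMul_one]
    | succ n ih => rw [pow_succ, ← Matrix.vecMul_vecMul, ih, hw]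
  have hzero : ∀ w : ι → ℝ, (∀ i, 0 ≤ w i) → Matrix.vecMul w Q = w →
      ∀ j, w j = 0 → ∀ i, w i = 0 := by
    intro w hw0 hw j hj i
    obtain ⟨n, -, hn⟩ := h_irred i j
    have hsum : ∑ k, w k * (Q ^ n) k j = 0 := by
      rw [← hj]
      exact congrFun (hinv w hw n) j
    have := (Finset.sum_eq_zero_iff_of_nonneg
      fun k _ => mul_nonneg (hw0 k) (hpow n k j)).1 hsum i (Finset.mem_univ i)
    exact (mul_eq_zero.1 this).resolve_right hn.ne'
  have hvpos : ∀ i, 0 < v i := by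
    intro i
    refine (hv0 i).lt_of_ne' fun h => ?_
    have := hzero v hv0 hv i h
    simp [this] at hv1
  obtain ⟨j, hj⟩ := Finite.exists_min fun i => u i / v i
  have hw := hzero (u - (u j / v j) • v)
    (fun i => by
      have := (le_div_iff₀ (hvpos i)).1 (hj i)
      simpa using this)
    (by rw [Matrix.sub_vecMul, Matrix.smul_vecMul, hu, hv]) j
    (by simp [(hvpos j).ne'])
  have huv : ∀ i, u i = u j / v j * v i := fun i => by
    have := hw i
    simpa [sub_eq_zero] using this
  have hc : u j / v j = 1 := by
    have := hu1
    rwa [Finset.sum_congr rfl fun i _ => huv i, ← Finset.mul_sum, hv1, mul_one] at this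
  ext i
  rw [huv i, hc, one_mul]

/-- A joint law specified on rectangles `S × T × (-∞, x]` as the product of a finite measure, a
probability measure and an exponential distribution is that product. -/
lemma eq_smul_prod_expMeasure {m : ℝ} (hm : 0 < m) (ρ : Measure (ℝ × ℝ × ℝ)) [IsFiniteMeasure ρ]
    (κ ν : Measure ℝ) [IsFiniteMeasure κ] [IsFiniteMeasure ν] (c : ENNReal) (hc : c ≠ ⊤)
    (h : ∀ S T : Set ℝ, MeasurableSet S → MeasurableSet T → ∀ x : ℝ,
      ρ (S ×ˢ T ×ˢ Set.Iic x)
        = κ S * c * ν T * ENNReal.ofReal (1 - Real.exp (-m * x))) :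
    ρ = c • κ.prod (ν.prod (expMeasure m)) := by
  have := isProbabilityMeasure_expMeasure hm
  refine Measure.ext_prod₃ fun {S T U} hS hT hU => ?_
  have key : (ρ.restrict (S ×ˢ T ×ˢ Set.univ)).map (fun q => q.2.2)
      = (κ S * c * ν T) • expMeasure m := by
    have hfin : IsFiniteMeasure ((κ S * c * ν T) • expMeasure m) :=
      Measure.smul_finite _ (by finiteness)
    refine Measure.ext_of_Iic _ _ fun x => ?_
    rw [Measure.map_apply (by fun_prop) measurableSet_Iic,
      Measure.restrict_apply (measurableSet_Iic.preimage (by fun_prop)), Measure.smul_apply,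
      expMeasure_Iic hm, smul_eq_mul, ← h S T hS hT x]
    congr 1
    ext q
    simp only [Set.mem_inter_iff, Set.mem_preimage, Set.mem_prod, Set.mem_univ]
    tauto
  have hU' := congrArg (fun r => r U) key
  simp only [Measure.smul_apply, smul_eq_mul] at hU'
  rw [Measure.map_apply (by fun_prop) hU,
    Measure.restrict_apply (hU.preimage (by fun_prop))] at hU'
  rw [Measure.smul_apply, Measure.prod_prod, Measure.prod_prod, smul_eq_mul]
  calc ρ (S ×ˢ T ×ˢ U) = κ S * c * ν T * expMeasure m U := by
        rw [← hU']
        congr 1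
        ext q
        simp only [Set.mem_inter_iff, Set.mem_preimage, Set.mem_prod, Set.mem_univ]
        tauto
    _ = _ := by ring

/-- Markov-modulated alternating service model with exponential preparation times: the
quantities `ω_j(μ_ℓ) = E[e^{-μ_ℓ W}; Z = j]` satisfy the linear system
`ω_j(μ_ℓ) = ϖ_j - (μ_ℓ/(μ_j + μ_ℓ)) ∑_i p_{i,j} ω_i(μ_j) α_i(μ_j)`. -/
theorem stmt1 {Ω : Type*} [MeasurableSpace Ω] (Pr : Measure Ω) [IsProbabilityMeasure Pr]
    (M : ℕ) (hM : 1 ≤ M)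
    (p : Fin M → Fin M → ℝ) (ϖ : Fin M → ℝ) (μ : Fin M → ℝ)
    (hp_nonneg : ∀ i j, 0 ≤ p i j) (hp_row : ∀ i, ∑ j, p i j = 1)
    (h_irred : ∀ i j, ∃ n : ℕ, 0 < n ∧ 0 < ((Matrix.of p) ^ n) i j)
    (hϖ_nonneg : ∀ i, 0 ≤ ϖ i) (hϖ_sum : ∑ i, ϖ i = 1)
    (hϖ_stat : ∀ j, ∑ i, ϖ i * p i j = ϖ j)
    (hμ : ∀ j, 0 < μ j)
    (ν : Fin M → Measure ℝ) (hν : ∀ i, IsProbabilityMeasure (ν i))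
    (hν_supp : ∀ i, ν i (Set.Iio 0) = 0)
    (W : Ω → ℝ) (Z Z' : Ω → Fin M) (A B : Ω → ℝ)
    (hW : Measurable W) (hZ : Measurable Z) (hZ' : Measurable Z')
    (hA : Measurable A) (hB : Measurable B)
    (hW_nonneg : ∀ ω, 0 ≤ W ω)
    -- Joint conditional structure: given `Z = i`, `Z' = j` w.p. `p i j` (independently of
    -- `W`); given `Z = i`, `A ~ ν i`, conditionally independent of `(W, Z')`; given
    -- `Z' = j`, `B ~ Exp(μ j)`, conditionally independent of `(W, Z, A)`.
    (h_joint : ∀ (i j : Fin M) (S_W S_A : Set ℝ),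
      MeasurableSet S_W → MeasurableSet S_A → ∀ x : ℝ,
      Pr {ω | W ω ∈ S_W ∧ Z ω = i ∧ Z' ω = j ∧ A ω ∈ S_A ∧ B ω ≤ x}
        = Pr {ω | W ω ∈ S_W ∧ Z ω = i} * ENNReal.ofReal (p i j) * ν i S_A
            * ENNReal.ofReal (1 - Real.exp (-(μ j) * x)))
    -- Stationarity: `(max (0, B - A - W), Z')` has the same joint law as `(W, Z)`.
    (h_stat : Measure.map (fun ω => (max 0 (B ω - A ω - W ω), Z' ω)) Pr
        = Measure.map (fun ω => (W ω, Z ω)) Pr)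
    (α : Fin M → ℝ → ℝ) (hα : ∀ i s, α i s = ∫ x, Real.exp (-s * x) ∂(ν i)) :
    ∀ j ℓ : Fin M,
      (∫ ω in {ω | Z ω = j}, Real.exp (-(μ ℓ) * W ω) ∂Pr)
        = ϖ j - (μ ℓ / (μ j + μ ℓ)) * ∑ i, p i j *
            (∫ ω in {ω | Z ω = i}, Real.exp (-(μ j) * W ω) ∂Pr) * α i (μ j) := by
  have hZm : ∀ i, MeasurableSet {ω | Z ω = i} := fun i => hZ (measurableSet_singleton i)
  have hZ'm : ∀ j, MeasurableSet {ω | Z' ω = j} := fun j => hZ' (measurableSet_singleton j)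
  have hE : ∀ i j, MeasurableSet {ω | Z ω = i ∧ Z' ω = j} := fun i j => (hZm i).inter (hZ'm j)
  let κ : Fin M → Measure ℝ := fun i => (Pr.restrict {ω | Z ω = i}).map W
  have hκ_fin : ∀ i, IsFiniteMeasure (κ i) := fun i => inferInstance
  have hκ_nonneg : ∀ i, ∀ᵐ w ∂κ i, 0 ≤ w := fun i =>
    (ae_map_iff hW.aemeasurable measurableSet_Ici).2 (ae_of_all _ hW_nonneg)
  have hν_nonneg : ∀ i, ∀ᵐ a ∂ν i, 0 ≤ a := fun i => by
    simpa only [ae_iff, not_le] using! hν_supp i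
  have hκ_univ : ∀ i, (κ i).real Set.univ = Pr.real {ω | Z ω = i} := fun i => by
    rw [measureReal_def, Measure.map_apply hW MeasurableSet.univ, Set.preimage_univ,
      Measure.restrict_apply_univ, measureReal_def]
  have hlaw : ∀ i j, (Pr.restrict {ω | Z ω = i ∧ Z' ω = j}).map (fun ω => (W ω, A ω, B ω))
      = ENNReal.ofReal (p i j) • (κ i).prod ((ν i).prod (expMeasure (μ j))) := by
    intro i j
    refine eq_smul_prod_expMeasure (hμ j) _ _ _ _ ENNReal.ofReal_ne_top fun S T hS hT x => ?_
    rw [Measure.map_apply (by fun_prop) (hS.prod (hT.prod measurableSet_Iic)),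
      Measure.restrict_apply
        ((hS.prod (hT.prod measurableSet_Iic)).preimage (by fun_prop)),
      Measure.map_apply hW hS, Measure.restrict_apply (hW hS)]
    convert! h_joint i j S T hS hT x using 2
    ext ω
    simp only [Set.mem_inter_iff, Set.mem_preimage, Set.mem_prod, Set.mem_ofPred_eq, Set.mem_Iic]
    tauto
  have hsplit : ∀ j, (⋃ i, {ω | Z ω = i ∧ Z' ω = j}) = {ω | Z' ω = j} := fun j => by
    ext ω
    simp
  have hdisj : ∀ j, Pairwise (Function.onFun Disjoint fun i => {ω | Z ω = i ∧ Z' ω = j}) :=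
    fun j i k hik => Set.disjoint_left.2 fun ω h1 h2 => hik (h1.1.symm.trans h2.1)
  have hstat_set : ∀ (j : Fin M) (s : ℝ), ∫ ω in {ω | Z ω = j}, Real.exp (-s * W ω) ∂Pr
      = ∫ ω in {ω | Z' ω = j}, Real.exp (-s * max 0 (B ω - A ω - W ω)) ∂Pr := by
    intro j s
    have hset : MeasurableSet {q : ℝ × Fin M | q.2 = j} :=
      measurable_snd (measurableSet_singleton j)
    have hf : Measurable fun q : ℝ × Fin M => Real.exp (-s * q.1) := by fun_prop
    have h1 := setIntegral_map (μ := Pr) (g := fun ω => (W ω, Z ω)) hset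
      hf.aestronglyMeasurable (hW.prodMk hZ).aemeasurable
    have h2 := setIntegral_map (μ := Pr) (g := fun ω => (max 0 (B ω - A ω - W ω), Z' ω)) hset
      hf.aestronglyMeasurable
      ((show Measurable fun ω => max 0 (B ω - A ω - W ω) by fun_prop).prodMk hZ').aemeasurable
    rw [h_stat] at h2
    exact h1.symm.trans h2
  have htrans : ∀ (j : Fin M) (s : ℝ), 0 < s →
      ∫ ω in {ω | Z ω = j}, Real.exp (-s * W ω) ∂Pr
        = ∑ i, p i j * (Pr.real {ω | Z ω = i} - s / (μ j + s) *
            ((∫ ω in {ω | Z ω = i}, Real.exp (-(μ j) * W ω) ∂Pr) * α i (μ j))) := by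
    intro j s hs
    rw [hstat_set, ← hsplit, integral_iUnion_fintype (fun i => hE i j) (hdisj j) fun i =>
      integrable_exp_neg_mul _ hs.le (by fun_prop) (ae_of_all _ fun _ => le_max_left _ _)]
    refine Finset.sum_congr rfl fun i _ => ?_
    have hm : ∫ ω in {ω | Z ω = i ∧ Z' ω = j}, Real.exp (-s * max 0 (B ω - A ω - W ω)) ∂Pr
        = ∫ q, Real.exp (-s * max 0 (q.2.2 - q.2.1 - q.1))
          ∂((Pr.restrict {ω | Z ω = i ∧ Z' ω = j}).map (fun ω => (W ω, A ω, B ω))) := by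
      rw [integral_map (by fun_prop) (Measurable.aestronglyMeasurable (by fun_prop))]
    have := hν i
    rw [hm, hlaw, integral_smul_measure, ENNReal.toReal_ofReal (hp_nonneg i j), smul_eq_mul,
      integral_exp_neg_mul_max_prod (hμ j) hs _ _ (hκ_nonneg i) (hν_nonneg i), hκ_univ,
      integral_map hW.aemeasurable (Measurable.aestronglyMeasurable (by fun_prop)), hα]
  have hZ'_law : ∀ j, Pr.real {ω | Z' ω = j} = ∑ i, Pr.real {ω | Z ω = i} * p i j := by
    intro j
    rw [← hsplit, measureReal_def, measure_iUnion (hdisj j) fun i => hE i j, tsum_fintype,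
      ENNReal.toReal_sum fun _ _ => measure_ne_top _ _]
    refine Finset.sum_congr rfl fun i _ => ?_
    have := hν i
    have := isProbabilityMeasure_expMeasure (hμ j)
    have h := congrArg (fun r => r Set.univ) (hlaw i j)
    simp only [Measure.smul_apply, smul_eq_mul] at h
    rw [Measure.map_apply (by fun_prop) MeasurableSet.univ, Set.preimage_univ,
      Measure.restrict_apply_univ, ← Set.univ_prod_univ, Measure.prod_prod,
      measure_univ (μ := (ν i).prod (expMeasure (μ j))), mul_one] at h
    rw [h, ENNReal.toReal_mul, ENNReal.toReal_ofReal (hp_nonneg i j), ← measureReal_def,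
      hκ_univ, mul_comm]
  have hZ_eq : ∀ j, Pr.real {ω | Z ω = j} = Pr.real {ω | Z' ω = j} := by
    intro j
    simpa using hstat_set j 0
  have hne : Nonempty (Fin M) := ⟨⟨0, hM⟩⟩
  have hπ : (fun i => Pr.real {ω | Z ω = i}) = ϖ := by
    refine eq_of_vecMul_eq_of_irreducible (Matrix.of p) hp_nonneg h_irred _ _ hϖ_nonneg ?_
      hϖ_sum ?_ (funext hϖ_stat)
    · have hu : (⋃ i, {ω | Z ω = i}) = Set.univ := by
        ext ω
        simp
      have hd : Pairwise (Function.onFun Disjoint fun i => {ω | Z ω = i}) :=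
        fun i k hik => Set.disjoint_left.2 fun ω h1 h2 => hik (h1.symm.trans h2)
      simp only [measureReal_def]
      have h := measure_iUnion (μ := Pr) hd hZm
      rw [hu, measure_univ, tsum_fintype] at h
      rw [← ENNReal.toReal_sum fun _ _ => measure_ne_top _ _, ← h, ENNReal.toReal_one]
    · exact funext fun j => ((hZ_eq j).trans (hZ'_law j)).symm
  intro j ℓ
  rw [htrans j (μ ℓ) (hμ ℓ), ← hϖ_stat j, Finset.mul_sum, ← Finset.sum_sub_distrib]
  refine Finset.sum_congr rfl fun i _ => ?_
  rw [← congrFun hπ i]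
  ring
end

section
/- Consider the Markov-modulated alternating service model with mixed-Erlang preparation times. Let M ≥ 1, P = (p_{i,j}) an irreducible M×M stochastic matrix with stationary distribution ϖ, rates μ_1,…,μ_M > 0, mixing weights κ_1,…,κ_N ≥ 0 with Σ_{n=1}^N κ_n = 1, and service-time laws ν_i on [0,∞). For state j, the preparation-time distribution is F_{B|j}(x) = Σ_{n=1}^N κ_n (1 − e^{−μ_j x} Σ_{ℓ=0}^{n−1} (μ_j x)^ℓ/ℓ!) for x ≥ 0. Suppose (W, Z, Z', A, B) satisfy: conditionally on (W, Z = i), Z' = j with probability p_{i,j}; conditionally on Z = i, A ~ ν_i independent of (W, Z'); conditionally on Z' = j, B has distribution F_{B|j} independent of (W, Z, A); and (max(0, B − A − W), Z') has the same law as (W, Z). Define α_i^{(k)}(μ_j) := (−1)^k ∫ a^k e^{−μ_j a} ν_i(da) and ω_i^{(m)}(μ_j) := (−1)^m E[W^m e^{−μ_j W} 1_{Z=i}] (the k-th and m-th derivatives at μ_j of the transforms α_i and ω_i). Then for every j: P[W = 0, Z = j] = ϖ_j − Σ_{i=1}^M Σ_{n=1}^N Σ_{ℓ=0}^{n−1}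 Σ_{m=0}^{ℓ} κ_n p_{i,j} (μ_j^ℓ/ℓ!) C(ℓ,m) (−1)^ℓ α_i^{(ℓ−m)}(μ_j) ω_i^{(m)}(μ_j), and for every Borel S ⊆ (0,∞), P[W ∈ S, Z = j] = ∫_S Σ_{i=1}^M Σ_{n=1}^N Σ_{ℓ=0}^{n−1} Σ_{m=0}^{ℓ} κ_n p_{i,j} ((−1)^ℓ/ℓ!) C(ℓ,m) α_i^{(ℓ−m)}(μ_j) ω_i^{(m)}(μ_j) μ_j^n e^{−μ_j x} x^{n−ℓ−1}/(n−ℓ−1)! dx, where C(ℓ,m) is the binomial coefficient. -/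
open MeasureTheory ProbabilityTheory

theorem hasDerivAt_erlang_cdf (r x : ℝ) (n : ℕ) :
    HasDerivAt (fun x : ℝ => 1 - Real.exp (-r * x) *
        ∑ ℓ ∈ Finset.range (n + 1), (r * x) ^ ℓ / ℓ.factorial)
      (r ^ (n + 1) * x ^ n * Real.exp (-r * x) / n.factorial) x := by
  have hexp : HasDerivAt (fun x : ℝ => Real.exp (-r * x)) (Real.exp (-r * x) * (-r)) x := by
    simpa using ((hasDerivAt_id x).const_mul (-r)).exp
  have hlin : HasDerivAt (fun x : ℝ => r * x) r x := by
    simpa using (hasDerivAt_id x).const_mul r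
  induction n with
  | zero =>
    have := hexp.const_sub 1
    simp only [zero_add, Finset.range_one, Finset.sum_singleton, pow_zero, Nat.factorial_zero,
      Nat.cast_one, div_one, mul_one, pow_one]
    exact this.congr_deriv (by ring)
  | succ n ih =>
    have hterm := hexp.fun_mul ((hlin.fun_pow (n + 1)).div_const ((n + 1).factorial : ℝ))
    have := ih.fun_sub hterm
    have hfun : (fun x : ℝ => 1 - Real.exp (-r * x) *
        ∑ ℓ ∈ Finset.range (n + 1 + 1), (r * x) ^ ℓ / ℓ.factorial) = fun x : ℝ =>
        1 - Real.exp (-r * x) * ∑ ℓ ∈ Finset.range (n + 1), (r * x) ^ ℓ / ℓ.factorial -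
          Real.exp (-r * x) * ((r * x) ^ (n + 1) / (n + 1).factorial) := by
      funext y
      rw [Finset.sum_range_succ _ (n + 1)]
      ring
    rw [hfun]
    refine this.congr_deriv ?_
    have h1 : ((n + 1).factorial : ℝ) = (n + 1) * n.factorial := by
      rw [Nat.factorial_succ]; push_cast; ring
    have h2 : (n.factorial : ℝ) ≠ 0 := by positivity
    have h3 : (n + 1 : ℝ) ≠ 0 := by positivity
    rw [h1, Nat.add_sub_cancel]
    push_cast
    field_simp
    ring

theorem tendsto_erlang_cdf {r : ℝ} (hr : 0 < r) (n : ℕ) :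
    Filter.Tendsto (fun x : ℝ => 1 - Real.exp (-r * x) *
        ∑ ℓ ∈ Finset.range n, (r * x) ^ ℓ / ℓ.factorial) Filter.atTop (nhds 1) := by
  have hlin : Filter.Tendsto (fun x : ℝ => r * x) Filter.atTop Filter.atTop :=
    Filter.tendsto_id.const_mul_atTop hr
  have hsum : Filter.Tendsto (fun x : ℝ => ∑ ℓ ∈ Finset.range n,
      (r * x) ^ ℓ * Real.exp (-(r * x)) / ℓ.factorial) Filter.atTop
      (nhds (∑ ℓ ∈ Finset.range n, (0 : ℝ) / ℓ.factorial)) :=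
    tendsto_finsetSum _ fun ℓ _ =>
      ((Real.tendsto_pow_mul_exp_neg_atTop_nhds_zero ℓ).comp hlin).div_const _
  have := hsum.const_sub 1
  simp only [zero_div, Finset.sum_const_zero, sub_zero] at this
  refine this.congr fun x => ?_
  rw [Finset.mul_sum]
  congr 1
  refine Finset.sum_congr rfl fun ℓ _ => ?_
  rw [neg_mul]
  ring

/-- Distribution function of a mixture of Erlang laws with common rate `r`. -/
noncomputable def mixedErlangCDF (N : ℕ) (κ : ℕ → ℝ) (r x : ℝ) : ℝ :=
  ∑ n ∈ Finset.Icc 1 N, κ n *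
    (1 - Real.exp (-r * x) * ∑ ℓ ∈ Finset.range n, (r * x) ^ ℓ / ℓ.factorial)

/-- Density on `(0, ∞)` of a mixture of Erlang laws with common rate `r`. -/
noncomputable def mixedErlangPDF (N : ℕ) (κ : ℕ → ℝ) (r x : ℝ) : ℝ :=
  ∑ n ∈ Finset.Icc 1 N, κ n * (r ^ n * x ^ (n - 1) * Real.exp (-r * x) / (n - 1).factorial)

/-- A mixture of Erlang laws with common rate `r`. -/
noncomputable def mixedErlangMeasure (N : ℕ) (κ : ℕ → ℝ) (r : ℝ) : Measure ℝ :=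
  (volume.restrict (Set.Ioi 0)).withDensity fun x => ENNReal.ofReal (mixedErlangPDF N κ r x)

theorem hasDerivAt_mixedErlangCDF (N : ℕ) (κ : ℕ → ℝ) (r x : ℝ) :
    HasDerivAt (mixedErlangCDF N κ r) (mixedErlangPDF N κ r x) x := by
  unfold mixedErlangCDF mixedErlangPDF
  refine HasDerivAt.fun_sum fun n hn => HasDerivAt.const_mul _ ?_
  obtain ⟨k, rfl⟩ : ∃ k, n = k + 1 := ⟨n - 1, by have := (Finset.mem_Icc.1 hn).1; omega⟩
  simpa using hasDerivAt_erlang_cdf r x k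

theorem continuous_mixedErlangPDF (N : ℕ) (κ : ℕ → ℝ) (r : ℝ) :
    Continuous (mixedErlangPDF N κ r) := by
  unfold mixedErlangPDF
  fun_prop

theorem mixedErlangPDF_nonneg {N : ℕ} {κ : ℕ → ℝ} {r x : ℝ} (hκ : ∀ n, 0 ≤ κ n) (hr : 0 < r)
    (hx : 0 ≤ x) : 0 ≤ mixedErlangPDF N κ r x :=
  Finset.sum_nonneg fun n _ => mul_nonneg (hκ n) (by positivity)

theorem mixedErlangCDF_zero (N : ℕ) (κ : ℕ → ℝ) (r : ℝ) : mixedErlangCDF N κ r 0 = 0 := by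
  refine Finset.sum_eq_zero fun n hn => ?_
  obtain ⟨k, rfl⟩ : ∃ k, n = k + 1 := ⟨n - 1, by have := (Finset.mem_Icc.1 hn).1; omega⟩
  rw [Finset.sum_eq_single 0] <;> simp +contextual

theorem mixedErlangMeasure_Iic_of_nonneg {N : ℕ} {κ : ℕ → ℝ} {r x : ℝ} (hκ : ∀ n, 0 ≤ κ n)
    (hr : 0 < r) (hx : 0 ≤ x) :
    mixedErlangMeasure N κ r (Set.Iic x) = ENNReal.ofReal (mixedErlangCDF N κ r x) := by
  have hint : IntervalIntegrable (mixedErlangPDF N κ r) volume 0 x :=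
    (continuous_mixedErlangPDF N κ r).intervalIntegrable _ _
  rw [mixedErlangMeasure, withDensity_apply _ measurableSet_Iic,
    Measure.restrict_restrict measurableSet_Iic, Set.inter_comm, Set.Ioi_inter_Iic,
    ← ofReal_integral_eq_lintegral_ofReal ((intervalIntegrable_iff_integrableOn_Ioc_of_le hx).1 hint),
    ← intervalIntegral.integral_of_le hx, intervalIntegral.integral_eq_sub_of_hasDerivAt
      (fun y _ => hasDerivAt_mixedErlangCDF N κ r y) hint, mixedErlangCDF_zero, sub_zero]
  exact (ae_restrict_mem measurableSet_Ioc).mono fun y hy => mixedErlangPDF_nonneg hκ hr hy.1.le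

theorem mixedErlangMeasure_Iic_of_neg (N : ℕ) (κ : ℕ → ℝ) (r : ℝ) {x : ℝ} (hx : x < 0) :
    mixedErlangMeasure N κ r (Set.Iic x) = 0 := by
  rw [mixedErlangMeasure, withDensity_apply _ measurableSet_Iic,
    Measure.restrict_restrict measurableSet_Iic,
    (Set.disjoint_left.2 fun y hy hy' => by simp at hy hy'; linarith).inter_eq]
  simp

theorem isProbabilityMeasure_mixedErlangMeasure {N : ℕ} {κ : ℕ → ℝ} {r : ℝ}
    (hκ : ∀ n, 0 ≤ κ n) (hκ_sum : ∑ n ∈ Finset.Icc 1 N, κ n = 1) (hr : 0 < r) :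
    IsProbabilityMeasure (mixedErlangMeasure N κ r) := by
  have hlim : Filter.Tendsto (mixedErlangCDF N κ r) Filter.atTop (nhds 1) := by
    have : Filter.Tendsto (mixedErlangCDF N κ r) Filter.atTop
        (nhds (∑ n ∈ Finset.Icc 1 N, κ n * 1)) :=
      tendsto_finsetSum _ fun n _ => (tendsto_erlang_cdf hr n).const_mul _
    simpa [hκ_sum] using this
  have hd : ∀ x ∈ Set.Ici (0 : ℝ), HasDerivAt (mixedErlangCDF N κ r) (mixedErlangPDF N κ r x) x :=
    fun x _ => hasDerivAt_mixedErlangCDF N κ r x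
  have hnn : ∀ x ∈ Set.Ioi (0 : ℝ), 0 ≤ mixedErlangPDF N κ r x :=
    fun x hx => mixedErlangPDF_nonneg hκ hr (le_of_lt hx)
  refine ⟨?_⟩
  rw [mixedErlangMeasure, withDensity_apply _ MeasurableSet.univ, Measure.restrict_univ,
    ← ofReal_integral_eq_lintegral_ofReal (integrableOn_Ioi_deriv_of_nonneg' hd hnn hlim),
    integral_Ioi_of_hasDerivAt_of_nonneg' hd hnn hlim, mixedErlangCDF_zero]
  · simp
  · exact (ae_restrict_mem measurableSet_Ioi).mono hnn

/-- Translating the density turns the mass of `S - (a + w)` into an integral over `S`. -/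
theorem mixedErlangMeasure_preimage_sub {N : ℕ} {κ : ℕ → ℝ} {r a w : ℝ} (ha : 0 ≤ a) (hw : 0 ≤ w)
    {S : Set ℝ} (hS : MeasurableSet S) (hS0 : S ⊆ Set.Ioi 0) :
    mixedErlangMeasure N κ r {b | b - a - w ∈ S}
      = ∫⁻ x in S, ENNReal.ofReal (mixedErlangPDF N κ r (x + (w + a))) := by
  have hT : MeasurableSet {b : ℝ | b - a - w ∈ S} := by
    have : Measurable fun b : ℝ => b - a - w := by fun_prop
    exact this hS
  have hsub : {b : ℝ | b - a - w ∈ S} ∩ Set.Ioi 0 = {b : ℝ | b - a - w ∈ S} := by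
    refine Set.inter_eq_left.2 fun b hb => ?_
    have := hS0 hb
    simp only [Set.mem_Ioi] at this ⊢
    linarith
  rw [mixedErlangMeasure, withDensity_apply _ hT, Measure.restrict_restrict hT, hsub,
    ← lintegral_indicator hT, ← lintegral_indicator hS, ← lintegral_add_right_eq_self _ (w + a)]
  refine lintegral_congr fun x => ?_
  have hx : x + (w + a) ∈ {b : ℝ | b - a - w ∈ S} ↔ x ∈ S := by
    rw [Set.mem_ofPred_eq, show x + (w + a) - a - w = x by ring]
  by_cases h : x ∈ S
  · rw [Set.indicator_of_mem (hx.2 h), Set.indicator_of_mem h]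
  · rw [Set.indicator_of_notMem (hx.not.2 h), Set.indicator_of_notMem h]

theorem integrable_pow_mul_exp_neg {lam : Measure ℝ} [IsFiniteMeasure lam]
    (hlam : lam (Set.Iio 0) = 0) {r : ℝ} (hr : 0 < r) (k : ℕ) :
    Integrable (fun a : ℝ => a ^ k * Real.exp (-r * a)) lam := by
  refine Integrable.of_bound (C := k.factorial / r ^ k) (by fun_prop) ?_
  have hae : ∀ᵐ a ∂lam, 0 ≤ a := by
    rw [ae_iff]
    convert hlam using 2
    ext; simp
  filter_upwards [hae] with a ha
  have h := Real.pow_div_factorial_le_exp (r * a) (by positivity) k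
  rw [Real.norm_of_nonneg (by positivity), neg_mul, Real.exp_neg, ← div_eq_mul_inv,
    div_le_div_iff₀ (Real.exp_pos _) (by positivity)]
  rw [div_le_iff₀ (by positivity), mul_pow] at h
  linarith

theorem erlang_pdf_add (r x w a : ℝ) {n : ℕ} (hn : 1 ≤ n) :
    r ^ n * (x + (w + a)) ^ (n - 1) * Real.exp (-r * (x + (w + a))) / (n - 1).factorial
      = ∑ ℓ ∈ Finset.range n, ∑ m ∈ Finset.range (ℓ + 1),
          (ℓ.choose m / ℓ.factorial *
            (r ^ n * Real.exp (-r * x) * x ^ (n - ℓ - 1) / (n - ℓ - 1).factorial)) *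
            ((w ^ m * Real.exp (-r * w)) * (a ^ (ℓ - m) * Real.exp (-r * a))) := by
  obtain ⟨k, rfl⟩ : ∃ k, n = k + 1 := ⟨n - 1, by omega⟩
  have hexp : Real.exp (-r * (x + (w + a)))
      = Real.exp (-r * x) * (Real.exp (-r * w) * Real.exp (-r * a)) := by
    rw [← Real.exp_add, ← Real.exp_add]; congr 1; ring
  rw [hexp, add_comm x, Nat.add_sub_cancel, add_pow, Finset.mul_sum, Finset.sum_mul,
    Finset.sum_div]
  refine Finset.sum_congr rfl fun ℓ hℓ => ?_
  have hℓk : ℓ ≤ k := by have := Finset.mem_range.1 hℓ; omega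
  rw [add_pow, Finset.sum_mul, Finset.sum_mul, Finset.mul_sum, Finset.sum_mul, Finset.sum_div]
  refine Finset.sum_congr rfl fun m _ => ?_
  rw [Nat.cast_choose ℝ hℓk, show k + 1 - ℓ - 1 = k - ℓ by omega]
  have h1 : (k.factorial : ℝ) ≠ 0 := by positivity
  have h2 : (ℓ.factorial : ℝ) ≠ 0 := by positivity
  have h3 : ((k - ℓ).factorial : ℝ) ≠ 0 := by positivity
  field_simp

/-- Density on `(0, ∞)` of `B - A - W` for `W`, `A` nonnegative with laws `lam`, `nu` and `B` an
independent mixture of Erlang laws, expressed through exponential moments. -/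
noncomputable def mixedErlangShiftPDF (N : ℕ) (κ : ℕ → ℝ) (r : ℝ) (lam nu : Measure ℝ) (x : ℝ) :
    ℝ :=
  ∑ n ∈ Finset.Icc 1 N, ∑ ℓ ∈ Finset.range n, ∑ m ∈ Finset.range (ℓ + 1),
    κ n * (ℓ.choose m / ℓ.factorial *
      (r ^ n * Real.exp (-r * x) * x ^ (n - ℓ - 1) / (n - ℓ - 1).factorial)) *
      ((∫ w, w ^ m * Real.exp (-r * w) ∂lam) * ∫ a, a ^ (ℓ - m) * Real.exp (-r * a) ∂nu)

theorem lintegral_mixedErlangPDF_add {N : ℕ} {κ : ℕ → ℝ} {r x : ℝ} (hκ : ∀ n, 0 ≤ κ n)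
    (hr : 0 < r) (hx : 0 ≤ x) {lam nu : Measure ℝ} [IsFiniteMeasure lam] [IsFiniteMeasure nu]
    (hlam : lam (Set.Iio 0) = 0) (hnu : nu (Set.Iio 0) = 0) :
    0 ≤ mixedErlangShiftPDF N κ r lam nu x ∧
    ∫⁻ q, ENNReal.ofReal (mixedErlangPDF N κ r (x + (q.1 + q.2))) ∂(lam.prod nu)
      = ENNReal.ofReal (mixedErlangShiftPDF N κ r lam nu x) := by
  have hexpand : ∀ q : ℝ × ℝ, mixedErlangPDF N κ r (x + (q.1 + q.2))
      = ∑ n ∈ Finset.Icc 1 N, ∑ ℓ ∈ Finset.range n, ∑ m ∈ Finset.range (ℓ + 1),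
          κ n * (ℓ.choose m / ℓ.factorial *
            (r ^ n * Real.exp (-r * x) * x ^ (n - ℓ - 1) / (n - ℓ - 1).factorial)) *
            ((q.1 ^ m * Real.exp (-r * q.1)) * (q.2 ^ (ℓ - m) * Real.exp (-r * q.2))) := by
    intro q
    refine Finset.sum_congr rfl fun n hn => ?_
    rw [erlang_pdf_add r x q.1 q.2 (Finset.mem_Icc.1 hn).1, Finset.mul_sum]
    refine Finset.sum_congr rfl fun ℓ _ => ?_
    rw [Finset.mul_sum]
    exact Finset.sum_congr rfl fun m _ => by ring
  have hi : ∀ n ℓ m : ℕ, Integrable (fun q : ℝ × ℝ => κ n * (ℓ.choose m / ℓ.factorial *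
      (r ^ n * Real.exp (-r * x) * x ^ (n - ℓ - 1) / (n - ℓ - 1).factorial)) *
      ((q.1 ^ m * Real.exp (-r * q.1)) * (q.2 ^ (ℓ - m) * Real.exp (-r * q.2))))
      (lam.prod nu) := fun n ℓ m =>
    ((integrable_pow_mul_exp_neg hlam hr m).mul_prod
      (integrable_pow_mul_exp_neg hnu hr (ℓ - m))).const_mul _
  have hint : Integrable (fun q : ℝ × ℝ => mixedErlangPDF N κ r (x + (q.1 + q.2)))
      (lam.prod nu) := by
    simp only [hexpand]
    exact integrable_finsetSum _ fun n _ => integrable_finsetSum _ fun ℓ _ =>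
      integrable_finsetSum _ fun m _ => hi n ℓ m
  have hae : ∀ᵐ q ∂(lam.prod nu), 0 ≤ mixedErlangPDF N κ r (x + (q.1 + q.2)) := by
    have h1 : ∀ᵐ q ∂(lam.prod nu), 0 ≤ q.1 :=
      Measure.quasiMeasurePreserving_fst.ae (p := fun y : ℝ => 0 ≤ y) (by
        rw [ae_iff]; convert hlam using 2; ext; simp)
    have h2 : ∀ᵐ q ∂(lam.prod nu), 0 ≤ q.2 :=
      Measure.quasiMeasurePreserving_snd.ae (p := fun y : ℝ => 0 ≤ y) (by
        rw [ae_iff]; convert hnu using 2; ext; simp)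
    filter_upwards [h1, h2] with q h1 h2
    exact mixedErlangPDF_nonneg hκ hr (by positivity)
  have heq : ∫ q, mixedErlangPDF N κ r (x + (q.1 + q.2)) ∂(lam.prod nu)
      = mixedErlangShiftPDF N κ r lam nu x := by
    simp only [hexpand, mixedErlangShiftPDF]
    rw [integral_finsetSum _ fun n _ => integrable_finsetSum _ fun ℓ _ =>
      integrable_finsetSum _ fun m _ => hi n ℓ m]
    refine Finset.sum_congr rfl fun n _ => ?_
    rw [integral_finsetSum _ fun ℓ _ => integrable_finsetSum _ fun m _ => hi n ℓ m]
    refine Finset.sum_congr rfl fun ℓ _ => ?_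
    rw [integral_finsetSum _ fun m _ => hi n ℓ m]
    refine Finset.sum_congr rfl fun m _ => ?_
    rw [integral_const_mul, integral_prod_mul (fun w : ℝ => w ^ m * Real.exp (-r * w))
      (fun a : ℝ => a ^ (ℓ - m) * Real.exp (-r * a))]
  rw [← ofReal_integral_eq_lintegral_ofReal hint hae, heq]
  exact ⟨heq ▸ integral_nonneg_of_ae hae, rfl⟩

theorem prod_mixedErlangMeasure_apply {N : ℕ} {κ : ℕ → ℝ} {r : ℝ} (hκ : ∀ n, 0 ≤ κ n)
    (hr : 0 < r) [SFinite (mixedErlangMeasure N κ r)]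
    {lam nu : Measure ℝ} [IsFiniteMeasure lam] [IsFiniteMeasure nu]
    (hlam : lam (Set.Iio 0) = 0) (hnu : nu (Set.Iio 0) = 0)
    {S : Set ℝ} (hS : MeasurableSet S) (hS0 : S ⊆ Set.Ioi 0) :
    (lam.prod (nu.prod (mixedErlangMeasure N κ r))) {q | q.2.2 - q.2.1 - q.1 ∈ S}
      = ∫⁻ x in S, ENNReal.ofReal (mixedErlangShiftPDF N κ r lam nu x) := by
  have hg : Measurable fun q : ℝ × ℝ × ℝ => q.2.2 - q.2.1 - q.1 := by fun_prop
  have hcont := continuous_mixedErlangPDF N κ r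
  have hm3 : Measurable fun z : (ℝ × ℝ) × ℝ =>
      ENNReal.ofReal (mixedErlangPDF N κ r (z.2 + (z.1.1 + z.1.2))) :=
    ENNReal.measurable_ofReal.comp (hcont.comp (by fun_prop)).measurable
  have hlam' : ∀ᵐ w ∂lam, 0 ≤ w := by rw [ae_iff]; convert hlam using 2; ext; simp
  have hnu' : ∀ᵐ a ∂nu, 0 ≤ a := by rw [ae_iff]; convert hnu using 2; ext; simp
  calc (lam.prod (nu.prod (mixedErlangMeasure N κ r))) {q | q.2.2 - q.2.1 - q.1 ∈ S}
      = ∫⁻ w, ∫⁻ a, mixedErlangMeasure N κ r {b | b - a - w ∈ S} ∂nu ∂lam := by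
        have hT : MeasurableSet {q : ℝ × ℝ × ℝ | q.2.2 - q.2.1 - q.1 ∈ S} := hg hS
        rw [Measure.prod_apply hT]
        refine lintegral_congr fun w => ?_
        rw [Measure.prod_apply (measurable_prodMk_left hT)]
        rfl
    _ = ∫⁻ w, ∫⁻ a, (∫⁻ x in S, ENNReal.ofReal (mixedErlangPDF N κ r (x + (w + a)))) ∂nu ∂lam := by
        refine lintegral_congr_ae (hlam'.mono fun w hw => lintegral_congr_ae (hnu'.mono
          fun a ha => ?_))
        exact mixedErlangMeasure_preimage_sub ha hw hS hS0
    _ = ∫⁻ q, (∫⁻ x in S, ENNReal.ofReal (mixedErlangPDF N κ r (x + (q.1 + q.2))))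
          ∂(lam.prod nu) := by
        rw [lintegral_prod _ hm3.lintegral_prod_right'.aemeasurable]
    _ = ∫⁻ x in S, ∫⁻ q, ENNReal.ofReal (mixedErlangPDF N κ r (x + (q.1 + q.2)))
          ∂(lam.prod nu) :=
        lintegral_lintegral_swap hm3.aemeasurable
    _ = ∫⁻ x in S, ENNReal.ofReal (mixedErlangShiftPDF N κ r lam nu x) :=
        setLIntegral_congr_fun hS fun x hx =>
          (lintegral_mixedErlangPDF_add hκ hr (le_of_lt (hS0 hx)) hlam hnu).2

/-- A nonnegative vector fixed by an irreducible matrix and vanishing somewhere is zero. -/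
theorem eq_zero_of_vecMul_eq_self {ι : Type*} [Fintype ι] [DecidableEq ι] {p : Matrix ι ι ℝ}
    (hp : ∀ i j, 0 ≤ p i j) (hirr : ∀ i j, ∃ n : ℕ, 0 < n ∧ 0 < (p ^ n) i j) {d : ι → ℝ}
    (hd : ∀ i, 0 ≤ d i) (hfix : Matrix.vecMul d p = d) {i : ι} (hi : d i = 0) : d = 0 := by
  funext k
  obtain ⟨n, -, hn⟩ := hirr k i
  have hpow : ∀ n : ℕ, Matrix.vecMul d (p ^ n) = d := by
    intro n
    induction n with
    | zero => simp
    | succ n ih => rw [pow_succ, ← Matrix.vecMul_vecMul, ih, hfix]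
  have hnn : ∀ (n : ℕ) (i j : ι), 0 ≤ (p ^ n) i j := by
    intro n
    induction n with
    | zero => intro i j; rw [pow_zero, Matrix.one_apply]; split_ifs <;> simp
    | succ n ih =>
      intro i j
      rw [pow_succ, Matrix.mul_apply]
      exact Finset.sum_nonneg fun l _ => mul_nonneg (ih i l) (hp l j)
  have h0 : ∑ l, d l * (p ^ n) l i = 0 := by
    have := congrFun (hpow n) i
    rwa [hi] at this
  have := (Finset.sum_eq_zero_iff_of_nonneg
    (fun l _ => mul_nonneg (hd l) (hnn n l i))).1 h0 k (Finset.mem_univ k)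
  rcases mul_eq_zero.1 this with h | h
  · exact h
  · exact absurd h hn.ne'

/-- The stationary distribution of an irreducible nonnegative matrix is unique. -/
theorem stationary_unique {ι : Type*} [Fintype ι] [DecidableEq ι] {p : Matrix ι ι ℝ}
    (hp : ∀ i j, 0 ≤ p i j) (hirr : ∀ i j, ∃ n : ℕ, 0 < n ∧ 0 < (p ^ n) i j) {u v : ι → ℝ}
    (hv : ∀ i, 0 ≤ v i) (husum : ∑ i, u i = 1) (hvsum : ∑ i, v i = 1)
    (hufix : Matrix.vecMul u p = u) (hvfix : Matrix.vecMul v p = v) : u = v := by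
  have hpos : ∀ i, 0 < v i := by
    intro i
    refine lt_of_le_of_ne (hv i) fun h => ?_
    have := eq_zero_of_vecMul_eq_self hp hirr hv hvfix h.symm
    simp [this] at hvsum
  have hne : Nonempty ι := by
    by_contra h
    rw [not_nonempty_iff] at h
    simp at hvsum
  obtain ⟨i, hi⟩ := Finite.exists_min fun i => u i / v i
  set c := u i / v i with hc
  have hd : u - c • v = 0 := by
    refine eq_zero_of_vecMul_eq_self hp hirr (i := i) (fun k => ?_) ?_ ?_
    · have := (le_div_iff₀ (hpos k)).1 (hi k)
      simpa using this
    · rw [Matrix.sub_vecMul, Matrix.smul_vecMul, hufix, hvfix]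
    · simp [hc, (hpos i).ne']
  have huc : u = c • v := sub_eq_zero.1 hd
  have : c = 1 := by
    have h := husum
    rw [huc] at h
    simpa [← Finset.mul_sum, hvsum] using h
  rw [huc, this, one_smul]

theorem map_eq_smul_prod_mixedErlangMeasure {Ω ι : Type*} [MeasurableSpace Ω] {Pr : Measure Ω}
    [IsProbabilityMeasure Pr] {W A B : Ω → ℝ} (hW : Measurable W) (hA : Measurable A)
    (hB : Measurable B) (hB_nonneg : ∀ᵐ ω ∂Pr, 0 ≤ B ω) {Z Z' : Ω → ι} {i j : ι}
    (hZi : MeasurableSet {ω | Z ω = i}) (hZj : MeasurableSet {ω | Z' ω = j})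
    {N : ℕ} {κ : ℕ → ℝ} {r : ℝ} (hκ : ∀ n, 0 ≤ κ n) (hr : 0 < r)
    [IsProbabilityMeasure (mixedErlangMeasure N κ r)] {nu : Measure ℝ} [IsProbabilityMeasure nu]
    {c : ENNReal}
    (hjoint : ∀ S T : Set ℝ, MeasurableSet S → MeasurableSet T → ∀ x : ℝ, 0 ≤ x →
      Pr {ω | W ω ∈ S ∧ Z ω = i ∧ Z' ω = j ∧ A ω ∈ T ∧ B ω ≤ x}
        = Pr {ω | W ω ∈ S ∧ Z ω = i} * c * nu T * ENNReal.ofReal (mixedErlangCDF N κ r x)) :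
    (Pr.restrict {ω | Z ω = i ∧ Z' ω = j}).map (fun ω => (W ω, A ω, B ω))
      = c • ((Pr.restrict {ω | Z ω = i}).map W).prod (nu.prod (mixedErlangMeasure N κ r)) := by
  have hE : MeasurableSet {ω | Z ω = i ∧ Z' ω = j} := hZi.inter hZj
  have hWAB : Measurable fun ω => (W ω, A ω, B ω) := hW.prodMk (hA.prodMk hB)
  have hbox : ∀ S T : Set ℝ, MeasurableSet S → MeasurableSet T →
      (Pr.restrict ({ω | W ω ∈ S} ∩ ({ω | Z ω = i ∧ Z' ω = j} ∩ {ω | A ω ∈ T}))).map B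
        = (Pr {ω | W ω ∈ S ∧ Z ω = i} * c * nu T) • mixedErlangMeasure N κ r := by
    intro S T hS hT
    refine Measure.ext_of_Iic _ _ fun x => ?_
    rw [Measure.map_apply hB measurableSet_Iic, Measure.restrict_apply (hB measurableSet_Iic),
      Measure.smul_apply, smul_eq_mul]
    rcases lt_or_ge x 0 with hx | hx
    · rw [mixedErlangMeasure_Iic_of_neg N κ r hx, mul_zero]
      refine measure_mono_null (t := {ω | ¬ 0 ≤ B ω}) (fun ω hω => ?_) (ae_iff.1 hB_nonneg)
      have h : B ω ≤ x := hω.1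
      exact not_le.2 (h.trans_lt hx)
    · rw [mixedErlangMeasure_Iic_of_nonneg hκ hr hx, ← hjoint S T hS hT x hx]
      congr 1
      ext ω
      simp only [Set.mem_inter_iff, Set.mem_preimage, Set.mem_Iic, Set.mem_ofPred_eq]
      tauto
  refine Measure.ext_prod₃ fun {S T U} hS hT hU => ?_
  have h := congrArg (fun m => m U) (hbox S T hS hT)
  simp only [Measure.smul_apply, smul_eq_mul] at h
  rw [Measure.map_apply hB hU, Measure.restrict_apply (hB hU)] at h
  rw [Measure.map_apply hWAB (hS.prod (hT.prod hU)),
    Measure.restrict_apply (hWAB (hS.prod (hT.prod hU))), Measure.smul_apply, smul_eq_mul,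
    Measure.prod_prod, Measure.prod_prod, Measure.map_apply hW hS,
    Measure.restrict_apply (hW hS)]
  have h1 : (fun ω => (W ω, A ω, B ω)) ⁻¹' S ×ˢ T ×ˢ U ∩ {ω | Z ω = i ∧ Z' ω = j}
      = B ⁻¹' U ∩ ({ω | W ω ∈ S} ∩ ({ω | Z ω = i ∧ Z' ω = j} ∩ {ω | A ω ∈ T})) := by
    ext ω
    simp only [Set.mem_inter_iff, Set.mem_preimage, Set.mem_prod, Set.mem_ofPred_eq]
    tauto
  have h2 : W ⁻¹' S ∩ {ω | Z ω = i} = {ω | W ω ∈ S ∧ Z ω = i} := rfl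
  rw [h1, h, h2]
  ring

theorem integral_pow_mul_exp_neg_Ioi {r : ℝ} (hr : 0 < r) (k : ℕ) :
    ∫ x in Set.Ioi (0 : ℝ), x ^ k * Real.exp (-r * x) = k.factorial / r ^ (k + 1) := by
  have h := Real.integral_rpow_mul_exp_neg_mul_Ioi (a := k + 1) (by positivity) hr
  rw [Real.Gamma_nat_eq_factorial] at h
  rw [div_eq_inv_mul, ← one_div, ← one_div_pow]
  have h2 : (1 / r) ^ ((k : ℝ) + 1) = (1 / r) ^ (k + 1) := by
    exact_mod_cast Real.rpow_natCast (1 / r) (k + 1)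
  rw [← h2, ← h]
  refine setIntegral_congr_fun measurableSet_Ioi fun x _ => ?_
  simp [neg_mul]

theorem integrableOn_pow_mul_exp_neg_Ioi {r : ℝ} (hr : 0 < r) (k : ℕ) :
    IntegrableOn (fun x : ℝ => x ^ k * Real.exp (-r * x)) (Set.Ioi 0) := by
  have := integrableOn_rpow_mul_exp_neg_mul_rpow (s := k) (p := 1) (b := r)
    (by have : (0 : ℝ) ≤ k := by positivity
        linarith) one_pos hr
  simpa using this

theorem integrableOn_mixedErlangShiftPDF (N : ℕ) (κ : ℕ → ℝ) {r : ℝ} (hr : 0 < r)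
    (lam nu : Measure ℝ) : IntegrableOn (mixedErlangShiftPDF N κ r lam nu) (Set.Ioi 0) := by
  unfold mixedErlangShiftPDF
  refine integrable_finsetSum _ fun n _ => integrable_finsetSum _ fun ℓ _ =>
      integrable_finsetSum _ fun m _ => Integrable.mul_const (Integrable.const_mul
        (Integrable.const_mul (Integrable.div_const ?_ _) _) _) _
  refine ((integrableOn_pow_mul_exp_neg_Ioi hr (n - ℓ - 1)).const_mul (r ^ n)).congr
    (.of_forall fun x => ?_)
  ring

theorem integral_mixedErlangShiftPDF (N : ℕ) (κ : ℕ → ℝ) {r : ℝ} (hr : 0 < r)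
    (lam nu : Measure ℝ) :
    ∫ x in Set.Ioi 0, mixedErlangShiftPDF N κ r lam nu x
      = ∑ n ∈ Finset.Icc 1 N, ∑ ℓ ∈ Finset.range n, ∑ m ∈ Finset.range (ℓ + 1),
          κ n * (ℓ.choose m / ℓ.factorial * r ^ ℓ) *
          ((∫ w, w ^ m * Real.exp (-r * w) ∂lam) * ∫ a, a ^ (ℓ - m) * Real.exp (-r * a) ∂nu) := by
  have hrw : ∀ x : ℝ, ∀ n ℓ m : ℕ, κ n * (ℓ.choose m / ℓ.factorial *
      (r ^ n * Real.exp (-r * x) * x ^ (n - ℓ - 1) / (n - ℓ - 1).factorial)) *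
      ((∫ w, w ^ m * Real.exp (-r * w) ∂lam) * ∫ a, a ^ (ℓ - m) * Real.exp (-r * a) ∂nu)
      = κ n * (ℓ.choose m / ℓ.factorial * (r ^ n / (n - ℓ - 1).factorial)) *
      ((∫ w, w ^ m * Real.exp (-r * w) ∂lam) * ∫ a, a ^ (ℓ - m) * Real.exp (-r * a) ∂nu) *
      (x ^ (n - ℓ - 1) * Real.exp (-r * x)) := fun x n ℓ m => by ring
  have hi : ∀ n ℓ m : ℕ, IntegrableOn (fun x : ℝ =>
      κ n * (ℓ.choose m / ℓ.factorial * (r ^ n / (n - ℓ - 1).factorial)) *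
      ((∫ w, w ^ m * Real.exp (-r * w) ∂lam) * ∫ a, a ^ (ℓ - m) * Real.exp (-r * a) ∂nu) *
      (x ^ (n - ℓ - 1) * Real.exp (-r * x))) (Set.Ioi 0) := fun n ℓ m =>
    (integrableOn_pow_mul_exp_neg_Ioi hr (n - ℓ - 1)).const_mul _
  simp only [mixedErlangShiftPDF, hrw]
  rw [integral_finsetSum _ fun n _ => integrable_finsetSum _ fun ℓ _ =>
    integrable_finsetSum _ fun m _ => hi n ℓ m]
  refine Finset.sum_congr rfl fun n _ => ?_
  rw [integral_finsetSum _ fun ℓ _ => integrable_finsetSum _ fun m _ => hi n ℓ m]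
  refine Finset.sum_congr rfl fun ℓ hℓ => ?_
  rw [integral_finsetSum _ fun m _ => hi n ℓ m]
  refine Finset.sum_congr rfl fun m _ => ?_
  rw [integral_const_mul, integral_pow_mul_exp_neg_Ioi hr]
  obtain ⟨k, rfl⟩ : ∃ k, n = ℓ + (k + 1) :=
    ⟨n - ℓ - 1, by have := Finset.mem_range.1 hℓ; omega⟩
  rw [show ℓ + (k + 1) - ℓ - 1 = k by omega, pow_add]
  have h1 : (k.factorial : ℝ) ≠ 0 := by positivity
  have h2 : r ^ (k + 1) ≠ 0 := by positivity
  field_simp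

/-- Markov-modulated alternating service model with mixed-Erlang preparation times:
for every state `j`, `P[W = 0, Z = j]` equals
`ϖ_j - ∑_{i,n,ℓ,m} κ_n p_{i,j} (μ_j^ℓ/ℓ!) C(ℓ,m) (-1)^ℓ α_i^{(ℓ-m)}(μ_j) ω_i^{(m)}(μ_j)`
and on `(0,∞)` the (defective) law of `W` on `{Z = j}` has the stated density, where
`α_i^{(k)}(μ_j) = (-1)^k ∫ a^k e^{-μ_j a} ν_i(da)` and
`ω_i^{(m)}(μ_j) = (-1)^m E[W^m e^{-μ_j W}; Z = i]`. -/
theorem stmt2 {Ω : Type*} [MeasurableSpace Ω] (Pr : Measure Ω) [IsProbabilityMeasure Pr]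
    (M : ℕ) (hM : 1 ≤ M)
    (p : Fin M → Fin M → ℝ) (ϖ : Fin M → ℝ) (μ : Fin M → ℝ)
    (hp_nonneg : ∀ i j, 0 ≤ p i j) (hp_row : ∀ i, ∑ j, p i j = 1)
    (h_irred : ∀ i j, ∃ n : ℕ, 0 < n ∧ 0 < ((Matrix.of p) ^ n) i j)
    (hϖ_nonneg : ∀ i, 0 ≤ ϖ i) (hϖ_sum : ∑ i, ϖ i = 1)
    (hϖ_stat : ∀ j, ∑ i, ϖ i * p i j = ϖ j)
    (hμ : ∀ j, 0 < μ j)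
    (N : ℕ) (hN : 1 ≤ N) (κ : ℕ → ℝ)
    (hκ_nonneg : ∀ n, 0 ≤ κ n) (hκ_sum : ∑ n ∈ Finset.Icc 1 N, κ n = 1)
    (ν : Fin M → Measure ℝ) (hν : ∀ i, IsProbabilityMeasure (ν i))
    (hν_supp : ∀ i, ν i (Set.Iio 0) = 0)
    (W : Ω → ℝ) (Z Z' : Ω → Fin M) (A B : Ω → ℝ)
    (hW : Measurable W) (hZ : Measurable Z) (hZ' : Measurable Z')
    (hA : Measurable A) (hB : Measurable B)
    (hW_nonneg : ∀ ω, 0 ≤ W ω) (hB_nonneg : ∀ᵐ ω ∂Pr, 0 ≤ B ω)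
    -- Joint conditional structure: given `Z = i`, `Z' = j` w.p. `p i j` (independently of
    -- `W`); given `Z = i`, `A ~ ν i`, conditionally independent of `(W, Z')`; given
    -- `Z' = j`, `B` has the mixed-Erlang distribution `F_{B|j}`, conditionally
    -- independent of `(W, Z, A)`.
    (h_joint : ∀ (i j : Fin M) (S_W S_A : Set ℝ),
      MeasurableSet S_W → MeasurableSet S_A → ∀ x : ℝ, 0 ≤ x →
      Pr {ω | W ω ∈ S_W ∧ Z ω = i ∧ Z' ω = j ∧ A ω ∈ S_A ∧ B ω ≤ x}
        = Pr {ω | W ω ∈ S_W ∧ Z ω = i} * ENNReal.ofReal (p i j) * ν i S_A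
            * ENNReal.ofReal (∑ n ∈ Finset.Icc 1 N, κ n *
                (1 - Real.exp (-(μ j) * x) *
                  ∑ ℓ ∈ Finset.range n, (μ j * x) ^ ℓ / ℓ.factorial)))
    -- Stationarity: `(max (0, B - A - W), Z')` has the same joint law as `(W, Z)`.
    (h_stat : Measure.map (fun ω => (max 0 (B ω - A ω - W ω), Z' ω)) Pr
        = Measure.map (fun ω => (W ω, Z ω)) Pr)
    -- `αd j i k` is the `k`-th derivative of the transform `α_i` at `μ j`, i.e.
    -- `(-1)^k ∫ a^k e^{-μ_j a} ν_i(da)`.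
    (αd : Fin M → Fin M → ℕ → ℝ)
    (hαd : ∀ j i k, αd j i k = (-1 : ℝ) ^ k * ∫ a, a ^ k * Real.exp (-(μ j) * a) ∂(ν i))
    -- `ωd j i m` is the `m`-th derivative of `ω_i` at `μ j`, i.e.
    -- `(-1)^m E[W^m e^{-μ_j W}; Z = i]`.
    (ωd : Fin M → Fin M → ℕ → ℝ)
    (hωd : ∀ j i m, ωd j i m
      = (-1 : ℝ) ^ m * ∫ ω in {ω | Z ω = i}, W ω ^ m * Real.exp (-(μ j) * W ω) ∂Pr) :
    ∀ j : Fin M,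
      Pr {ω | W ω = 0 ∧ Z ω = j}
          = ENNReal.ofReal (ϖ j -
              ∑ i, ∑ n ∈ Finset.Icc 1 N, ∑ ℓ ∈ Finset.range n, ∑ m ∈ Finset.range (ℓ + 1),
                κ n * p i j * ((μ j) ^ ℓ / ℓ.factorial) * (ℓ.choose m) * (-1 : ℝ) ^ ℓ *
                  αd j i (ℓ - m) * ωd j i m)
        ∧ ∀ S : Set ℝ, MeasurableSet S → S ⊆ Set.Ioi 0 →
            Pr {ω | W ω ∈ S ∧ Z ω = j}
              = ENNReal.ofReal (∫ x in S,
                  ∑ i, ∑ n ∈ Finset.Icc 1 N, ∑ ℓ ∈ Finset.range n,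
                    ∑ m ∈ Finset.range (ℓ + 1),
                    κ n * p i j * ((-1 : ℝ) ^ ℓ / ℓ.factorial) * (ℓ.choose m) *
                      αd j i (ℓ - m) * ωd j i m *
                      (μ j) ^ n * Real.exp (-(μ j) * x) *
                      x ^ (n - ℓ - 1) / (n - ℓ - 1).factorial) := by
  intro j
  have hprob : ∀ j, IsProbabilityMeasure (mixedErlangMeasure N κ (μ j)) := fun j =>
    isProbabilityMeasure_mixedErlangMeasure hκ_nonneg hκ_sum (hμ j)
  have hZm : ∀ i, MeasurableSet {ω | Z ω = i} := fun i => hZ (measurableSet_singleton i)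
  have hZm' : ∀ i, MeasurableSet {ω | Z' ω = i} := fun i => hZ' (measurableSet_singleton i)
  have hWAB : Measurable fun ω => (W ω, A ω, B ω) := hW.prodMk (hA.prodMk hB)
  let lam : Fin M → Measure ℝ := fun i => (Pr.restrict {ω | Z ω = i}).map W
  have hlam_fin : ∀ i, IsFiniteMeasure (lam i) := fun i => inferInstance
  have hlam_supp : ∀ i, lam i (Set.Iio 0) = 0 := by
    intro i
    have : W ⁻¹' Set.Iio 0 = ∅ := by
      ext ω
      simpa using hW_nonneg ω
    simp only [lam]
    rw [Measure.map_apply hW measurableSet_Iio, this, measure_empty]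
  have hlaw : ∀ i j, (Pr.restrict {ω | Z ω = i ∧ Z' ω = j}).map (fun ω => (W ω, A ω, B ω))
      = ENNReal.ofReal (p i j) • (lam i).prod ((ν i).prod (mixedErlangMeasure N κ (μ j))) :=
    fun i j => map_eq_smul_prod_mixedErlangMeasure hW hA hB hB_nonneg (hZm i) (hZm' j)
      hκ_nonneg (hμ j) (h_joint i j)
  -- Splitting an event over the previous state of the modulating chain.
  have hsplit : ∀ (j : Fin M) (V : Set (ℝ × ℝ × ℝ)), MeasurableSet V →
      Pr {ω | (W ω, A ω, B ω) ∈ V ∧ Z' ω = j} = ∑ i, ENNReal.ofReal (p i j) *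
        ((lam i).prod ((ν i).prod (mixedErlangMeasure N κ (μ j)))) V := by
    intro j V hV
    have hms : MeasurableSet {ω | (W ω, A ω, B ω) ∈ V ∧ Z' ω = j} := (hWAB hV).inter (hZm' j)
    have h := sum_measure_preimage_singleton
      (μ := Pr.restrict {ω | (W ω, A ω, B ω) ∈ V ∧ Z' ω = j}) Finset.univ (f := Z)
      fun i _ => hZm i
    rw [Finset.coe_univ, Set.preimage_univ, Measure.restrict_apply_univ] at h
    rw [← h]
    refine Finset.sum_congr rfl fun i _ => ?_
    rw [← smul_eq_mul, ← Measure.smul_apply, ← hlaw i j, Measure.map_apply hWAB hV,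
      Measure.restrict_apply (hWAB hV),
      Measure.restrict_apply (hZ (measurableSet_singleton i))]
    congr 1
    ext ω
    simp only [Set.mem_inter_iff, Set.mem_preimage, Set.mem_ofPred_eq, Set.mem_singleton_iff]
    tauto
  have hstat : ∀ (j : Fin M) (S : Set ℝ), MeasurableSet S →
      Pr {ω | W ω ∈ S ∧ Z ω = j} = Pr {ω | max 0 (B ω - A ω - W ω) ∈ S ∧ Z' ω = j} := by
    intro j S hS
    have h := congrArg (fun m => m (S ×ˢ {j})) h_stat
    have hSj : MeasurableSet (S ×ˢ ({j} : Set (Fin M))) := hS.prod (measurableSet_singleton j)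
    have hm : Measurable fun ω => (max 0 (B ω - A ω - W ω), Z' ω) := by fun_prop
    rw [Measure.map_apply hm hSj, Measure.map_apply (hW.prodMk hZ) hSj] at h
    exact h.symm
  have hmarg : ∀ j, Pr.real {ω | Z ω = j} = ϖ j := by
    have hfix : ∀ j, ∑ i, Pr.real {ω | Z ω = i} * p i j = Pr.real {ω | Z ω = j} := by
      intro j
      have h1 := hstat j Set.univ MeasurableSet.univ
      have h2 := hsplit j Set.univ MeasurableSet.univ
      simp only [Set.mem_univ, true_and] at h1 h2
      rw [measureReal_def, h1, h2, ENNReal.toReal_sum fun i _ =>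
        ENNReal.mul_ne_top ENNReal.ofReal_ne_top (measure_ne_top _ _)]
      refine Finset.sum_congr rfl fun i _ => ?_
      have h3 : lam i Set.univ = Pr {ω | Z ω = i} := by
        simp only [lam]
        rw [Measure.map_apply hW MeasurableSet.univ, Set.preimage_univ,
          Measure.restrict_apply_univ]
      rw [← Set.univ_prod_univ, Measure.prod_prod, h3, measure_univ, mul_one,
        ENNReal.toReal_mul, ENNReal.toReal_ofReal (hp_nonneg i j), mul_comm, measureReal_def]
    have hsum : ∑ i, Pr.real {ω | Z ω = i} = 1 := by
      have h := sum_measure_preimage_singleton (μ := Pr) Finset.univ (f := Z) fun i _ => hZm i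
      rw [Finset.coe_univ, Set.preimage_univ, measure_univ] at h
      simp only [measureReal_def]
      rw [← ENNReal.toReal_sum fun i _ => measure_ne_top _ _]
      exact (congrArg ENNReal.toReal h).trans ENNReal.toReal_one
    exact congrFun (stationary_unique (p := Matrix.of p) hp_nonneg h_irred hϖ_nonneg hsum hϖ_sum
      (funext hfix) (funext hϖ_stat))
  let h : ℝ → ℝ := fun x => ∑ i, p i j * mixedErlangShiftPDF N κ (μ j) (lam i) (ν i) x
  have hh_nonneg : ∀ x, 0 ≤ x → 0 ≤ h x := fun x hx => Finset.sum_nonneg fun i _ =>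
    mul_nonneg (hp_nonneg i j) (lintegral_mixedErlangPDF_add hκ_nonneg (hμ j) hx
      (hlam_supp i) (hν_supp i)).1
  have hh_int : IntegrableOn h (Set.Ioi 0) := integrable_finsetSum _ fun i _ =>
    (integrableOn_mixedErlangShiftPDF N κ (hμ j) (lam i) (ν i)).const_mul _
  have hdens : ∀ S : Set ℝ, MeasurableSet S → S ⊆ Set.Ioi 0 →
      Pr {ω | W ω ∈ S ∧ Z ω = j} = ENNReal.ofReal (∫ x in S, h x) := by
    intro S hS hS0
    have hg : Measurable fun q : ℝ × ℝ × ℝ => q.2.2 - q.2.1 - q.1 := by fun_prop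
    have hV : MeasurableSet {q : ℝ × ℝ × ℝ | q.2.2 - q.2.1 - q.1 ∈ S} := hg hS
    have hset : {ω | max 0 (B ω - A ω - W ω) ∈ S ∧ Z' ω = j}
        = {ω | (W ω, A ω, B ω) ∈ {q : ℝ × ℝ × ℝ | q.2.2 - q.2.1 - q.1 ∈ S} ∧ Z' ω = j} := by
      ext ω
      simp only [Set.mem_ofPred_eq]
      refine and_congr_left fun _ => ?_
      rcases le_or_gt (B ω - A ω - W ω) 0 with hle | hgt
      · rw [max_eq_left hle]
        exact ⟨fun h0 => absurd (hS0 h0) (by simp),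
          fun h0 => absurd (Set.mem_Ioi.1 (hS0 h0)) (not_lt.2 hle)⟩
      · rw [max_eq_right hgt.le]
    have hmeas : ∀ i, AEMeasurable (fun x => ENNReal.ofReal (p i j) * ENNReal.ofReal
        (mixedErlangShiftPDF N κ (μ j) (lam i) (ν i) x)) (volume.restrict S) := fun i =>
      (((integrableOn_mixedErlangShiftPDF N κ (hμ j) (lam i) (ν i)).mono_set
        hS0).aemeasurable.ennreal_ofReal).const_mul _
    rw [hstat j S hS, hset, hsplit j _ hV, ofReal_integral_eq_lintegral_ofReal
      (hh_int.mono_set hS0) ((ae_restrict_mem hS).mono fun x hx => hh_nonneg x (hS0 hx).le)]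
    calc _ = ∑ i, ∫⁻ x in S, ENNReal.ofReal (p i j) * ENNReal.ofReal
          (mixedErlangShiftPDF N κ (μ j) (lam i) (ν i) x) := by
          refine Finset.sum_congr rfl fun i _ => ?_
          rw [prod_mixedErlangMeasure_apply hκ_nonneg (hμ j) (hlam_supp i) (hν_supp i) hS hS0,
            lintegral_const_mul' _ _ ENNReal.ofReal_ne_top]
      _ = ∫⁻ x in S, ∑ i, ENNReal.ofReal (p i j) * ENNReal.ofReal
          (mixedErlangShiftPDF N κ (μ j) (lam i) (ν i) x) :=
          (lintegral_finsetSum' _ fun i _ => hmeas i).symm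
      _ = _ := by
          refine setLIntegral_congr_fun hS fun x hx => ?_
          have hnn : ∀ i, 0 ≤ mixedErlangShiftPDF N κ (μ j) (lam i) (ν i) x := fun i =>
            (lintegral_mixedErlangPDF_add hκ_nonneg (hμ j) (hS0 hx).le
              (hlam_supp i) (hν_supp i)).1
          simp only [h]
          rw [ENNReal.ofReal_sum_of_nonneg fun i _ => mul_nonneg (hp_nonneg i j) (hnn i)]
          exact Finset.sum_congr rfl fun i _ => (ENNReal.ofReal_mul (hp_nonneg i j)).symm
  have hω : ∀ i m, ωd j i m = (-1 : ℝ) ^ m * ∫ w, w ^ m * Real.exp (-(μ j) * w) ∂(lam i) := by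
    intro i m
    rw [hωd]
    simp only [lam]
    rw [integral_map hW.aemeasurable (by fun_prop)]
  -- The signs of the two derivatives combine to `(-1) ^ ℓ`.
  have hsign : ∀ ℓ m : ℕ, m ≤ ℓ → (-1 : ℝ) ^ ℓ * (-1) ^ (ℓ - m) * (-1) ^ m = 1 := by
    intro ℓ m hm
    rw [mul_assoc, ← pow_add, Nat.sub_add_cancel hm, ← mul_pow]
    simp
  constructor
  · have hpos := hdens (Set.Ioi 0) measurableSet_Ioi subset_rfl
    have hI : ∫ x in Set.Ioi 0, h x = ∑ i, ∑ n ∈ Finset.Icc 1 N, ∑ ℓ ∈ Finset.range n,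
        ∑ m ∈ Finset.range (ℓ + 1),
          κ n * p i j * ((μ j) ^ ℓ / ℓ.factorial) * (ℓ.choose m) * (-1 : ℝ) ^ ℓ *
            αd j i (ℓ - m) * ωd j i m := by
      simp only [h]
      rw [integral_finsetSum _ fun i _ =>
        (integrableOn_mixedErlangShiftPDF N κ (hμ j) (lam i) (ν i)).const_mul _]
      refine Finset.sum_congr rfl fun i _ => ?_
      rw [integral_const_mul, integral_mixedErlangShiftPDF N κ (hμ j)]
      simp only [Finset.mul_sum]
      refine Finset.sum_congr rfl fun n _ => Finset.sum_congr rfl fun ℓ _ =>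
        Finset.sum_congr rfl fun m hm => ?_
      rw [hω, hαd]
      have hs := hsign ℓ m (Nat.lt_succ_iff.1 (Finset.mem_range.1 hm))
      linear_combination (-(κ n * p i j * ((μ j) ^ ℓ / ℓ.factorial) * (ℓ.choose m) *
        (∫ a, a ^ (ℓ - m) * Real.exp (-(μ j) * a) ∂(ν i)) *
        (∫ w, w ^ m * Real.exp (-(μ j) * w) ∂(lam i)))) * hs
    rw [← hI, ENNReal.ofReal_sub _ (setIntegral_nonneg measurableSet_Ioi fun x hx =>
      hh_nonneg x (le_of_lt hx)), ← hpos, ← hmarg j, ofReal_measureReal]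
    have hms : MeasurableSet {ω | W ω ∈ Set.Ioi 0 ∧ Z ω = j} :=
      (hW measurableSet_Ioi).inter (hZm j)
    have hsub : {ω | W ω ∈ Set.Ioi 0 ∧ Z ω = j} ⊆ {ω | Z ω = j} := fun ω hω => hω.2
    rw [← measure_sdiff hsub hms.nullMeasurableSet (measure_ne_top _ _)]
    congr 1
    ext ω
    have := hW_nonneg ω
    simp only [Set.mem_sdiff, Set.mem_ofPred_eq, Set.mem_Ioi]
    constructor
    · rintro ⟨h0, hz⟩
      exact ⟨hz, fun h1 => h1.1.ne' h0⟩
    · rintro ⟨hz, h1⟩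
      exact ⟨le_antisymm (not_lt.1 fun h2 => h1 ⟨h2, hz⟩) this, hz⟩
  · intro S hS hS0
    rw [hdens S hS hS0]
    congr 1
    refine setIntegral_congr_fun hS fun x _ => ?_
    simp only [h, mixedErlangShiftPDF, Finset.mul_sum]
    refine Finset.sum_congr rfl fun i _ => Finset.sum_congr rfl fun n _ =>
      Finset.sum_congr rfl fun ℓ _ => Finset.sum_congr rfl fun m hm => ?_
    rw [hω, hαd]
    have hs := hsign ℓ m (Nat.lt_succ_iff.1 (Finset.mem_range.1 hm))
    linear_combination (-(κ n * p i j * (1 / ℓ.factorial) * (ℓ.choose m) *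
      (∫ a, a ^ (ℓ - m) * Real.exp (-(μ j) * a) ∂(ν i)) *
      (∫ w, w ^ m * Real.exp (-(μ j) * w) ∂(lam i)) * (μ j) ^ n * Real.exp (-(μ j) * x) *
      x ^ (n - ℓ - 1) / (n - ℓ - 1).factorial)) * hs
end

section
/- Consider the alternating service model where the preparation time depends on the previous service time. Let λ > 0 and let A be exponentially distributed with rate λ. Let χ(s) = P₁(s)/Q₁(s) and ψ(s) = P₂(s)/Q₂(s) be rational functions with ψ(0) = 0 and χ(0) = 1, where P₂, Q₁, Q₂ are polynomials of degrees L, M, N respectively, and suppose that the conditional Laplace–Stieltjes transform of the preparation time B given A = t is E[e^{−sB} | A = t] = χ(s)e^{−ψ(s)t} (valid for all complex s with Re(s) ≥ 0 at which χ and ψ have no poles). Suppose W ≥ 0 is independent of the pair (A, B) and satisfies the stationarity condition that max(0, B − A − W) has the same distribution as W. Let D(s) := Q₁(s)·((λ − s)Q₂(s) + P₂(s)), a polynomial of degree K = max{M+N+1, M+L}, and assume D has K distinct complex zeros r_1, …, r_K. Then there exist a constant c_0 ∈ [0,1] and complex constants c_1, …, c_K (with c_i = 0 whenever Re(r_i)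 ≥ 0) such that P[W = 0] = c_0 and for every Borel set S ⊆ (0,∞), P[W ∈ S] = ∫_S Σ_{i=1}^K c_i e^{r_i x} dx (the integrand being real-valued on (0,∞)). -/
open MeasureTheory ProbabilityTheory Polynomial

lemma charFun_withDensity_ofReal {g : ℝ → ℝ} (hg : Measurable g) (t : ℝ) :
    charFun (volume.withDensity fun x => ENNReal.ofReal (g x)) t
      = ∫ x : ℝ, Complex.exp (t * x * Complex.I) * ((max (g x) 0 : ℝ) : ℂ) := by
  rw [charFun_apply_real, integral_withDensity_eq_integral_toReal_smul
    (by fun_prop) (by simp)]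
  refine integral_congr_ae (.of_forall fun x => ?_)
  simp only [ENNReal.toReal_ofReal', Complex.real_smul]
  ring

lemma Integrable.exp_mul_I_mul {f : ℝ → ℂ} (hf : Integrable f) (t : ℝ) :
    Integrable fun x : ℝ => Complex.exp (t * x * Complex.I) * f x := by
  refine hf.bdd_mul (c := 1) (by fun_prop) (.of_forall fun x => ?_)
  rw [← Complex.ofReal_mul, Complex.norm_exp_ofReal_mul_I]

/-- A finite measure whose characteristic function is that of `c δ₀ + g dx` agrees with `g dx`
away from `0`. -/
lemma measureReal_eq_setIntegral_of_charFun_real (ν : Measure ℝ) [IsFiniteMeasure ν] (c : ℝ)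
    {g : ℝ → ℝ} (hgm : Measurable g) (hg : Integrable g)
    (h : ∀ t : ℝ, charFun ν t = c + ∫ x : ℝ, Complex.exp (t * x * Complex.I) * g x)
    {S : Set ℝ} (hS : MeasurableSet S) (h0 : (0 : ℝ) ∉ S) :
    ν.real S = ∫ x in S, g x := by
  have := isFiniteMeasure_withDensity_ofReal hg.2
  have := isFiniteMeasure_withDensity_ofReal hg.neg.2
  set μp := volume.withDensity fun x => ENNReal.ofReal (g x) with hμp
  set μm := volume.withDensity fun x => ENNReal.ofReal ((-g) x) with hμm
  have key : ν + ((-c).toNNReal • Measure.dirac 0 + μm) = c.toNNReal • Measure.dirac 0 + μp := by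
    refine Measure.ext_of_charFun (funext fun t => ?_)
    have hint (κ : Measure ℝ) [IsFiniteMeasure κ] :
        Integrable (fun x : ℝ => Complex.exp (t * x * Complex.I)) κ := by
      refine Integrable.of_bound (C := 1) (by fun_prop) (.of_forall fun x => ?_)
      rw [← Complex.ofReal_mul, Complex.norm_exp_ofReal_mul_I]
    have hadd (κ κ' : Measure ℝ) [IsFiniteMeasure κ] [IsFiniteMeasure κ'] :
        charFun (κ + κ') t = charFun κ t + charFun κ' t := by
      simp only [charFun_apply_real]
      exact integral_add_measure (hint κ) (hint κ')
    have hdirac (a : NNReal) : charFun (a • Measure.dirac (0 : ℝ)) t = (a : ℝ) := by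
      rw [charFun_apply_real, integral_smul_nnreal_measure]
      simp [NNReal.smul_def]
    rw [hadd, hadd, hadd, hdirac, hdirac, h t, charFun_withDensity_ofReal hgm,
      charFun_withDensity_ofReal hgm.neg]
    have h1 : ∫ x : ℝ, Complex.exp (t * x * Complex.I) * g x
        = (∫ x : ℝ, Complex.exp (t * x * Complex.I) * ((max (g x) 0 : ℝ) : ℂ))
          - ∫ x : ℝ, Complex.exp (t * x * Complex.I) * ((max ((-g) x) 0 : ℝ) : ℂ) := by
      have hp : Integrable fun x => ((max (g x) 0 : ℝ) : ℂ) := hg.pos_part.ofReal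
      have hm : Integrable fun x => ((max ((-g) x) 0 : ℝ) : ℂ) := hg.neg.pos_part.ofReal
      rw [← integral_sub (Integrable.exp_mul_I_mul hp t) (Integrable.exp_mul_I_mul hm t)]
      congr 1 with x
      rw [← mul_sub, ← Complex.ofReal_sub, Pi.neg_apply]
      congr 2
      rcases le_total (g x) 0 with h | h <;> simp [h]
    have h2 : (c : ℂ) = (c.toNNReal : ℝ) - ((-c).toNNReal : ℝ) := by
      rw [← Complex.ofReal_sub]
      congr 1
      rcases le_total c 0 with h | h <;> simp [h]
    rw [h1]
    linear_combination h2
  have hS' := congrArg (fun κ : Measure ℝ => κ.real S) key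
  have hd (a : NNReal) : (a • Measure.dirac (0 : ℝ)).real S = 0 := by
    simp [measureReal_def, Measure.dirac_apply' _ hS, h0]
  beta_reduce at hS'
  rw [measureReal_add_apply, measureReal_add_apply, measureReal_add_apply, hd, hd, zero_add,
    zero_add] at hS'
  have hden {f : ℝ → ℝ} (hf : Integrable f) :
      (volume.withDensity fun x => ENNReal.ofReal (f x)).real S = ∫ x in S, max (f x) 0 := by
    rw [measureReal_def, withDensity_apply _ hS,
      integral_eq_lintegral_of_nonneg_ae (f := fun x => max (f x) 0) (.of_forall fun x => le_max_right _ _)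
        hf.pos_part.aestronglyMeasurable.restrict]
    simp [ENNReal.ofReal_max]
  rw [hμp, hμm, hden hg, hden hg.neg] at hS'
  rw [eq_sub_of_add_eq hS', ← integral_sub hg.pos_part.integrableOn hg.neg.pos_part.integrableOn]
  congr 1 with x
  rw [Pi.neg_apply]
  rcases le_total (g x) 0 with h | h <;> simp [h]

/-- Complex version of `measureReal_eq_setIntegral_of_charFun_real`. -/
lemma measureReal_eq_setIntegral_of_charFun (ν : Measure ℝ) [IsFiniteMeasure ν] (c : ℂ)
    {f : ℝ → ℂ} (hfm : Measurable f) (hf : Integrable f)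
    (h : ∀ t : ℝ, charFun ν t = c + ∫ x : ℝ, Complex.exp (t * x * Complex.I) * f x)
    {S : Set ℝ} (hS : MeasurableSet S) (h0 : (0 : ℝ) ∉ S) :
    (ν.real S : ℂ) = ∫ x in S, f x := by
  have hconj (t : ℝ) : charFun ν t = starRingEnd ℂ c
      + ∫ x : ℝ, Complex.exp (t * x * Complex.I) * starRingEnd ℂ (f x) := by
    rw [← neg_neg t, charFun_neg, h, map_add, ← integral_conj]
    congr 2 with x
    simp [← Complex.exp_conj]
  have hint := Integrable.exp_mul_I_mul hf
  have hint' (t : ℝ) := Integrable.exp_mul_I_mul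
    ((LinearIsometryEquiv.integrable_comp_iff Complex.conjLIE).2 hf) t
  simp only [Complex.conjLIE_apply] at hint'
  have hre := measureReal_eq_setIntegral_of_charFun_real ν c.re
    (Complex.measurable_re.comp hfm) hf.re (fun t => by
      have : ∫ x : ℝ, Complex.exp (t * x * Complex.I) * ((f x).re : ℂ)
          = ((∫ x : ℝ, Complex.exp (t * x * Complex.I) * f x)
            + ∫ x : ℝ, Complex.exp (t * x * Complex.I) * starRingEnd ℂ (f x)) / 2 := by
        rw [← integral_add (hint t) (hint' t), ← integral_div]
        congr 1 with x
        rw [Complex.re_eq_add_conj]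
        ring
      simp only [Function.comp]
      rw [this, Complex.re_eq_add_conj]
      linear_combination (h t + hconj t) / 2) hS h0
  have him := measureReal_eq_setIntegral_of_charFun_real 0 c.im
    (Complex.measurable_im.comp hfm) hf.im (fun t => by
      have : ∫ x : ℝ, Complex.exp (t * x * Complex.I) * ((f x).im : ℂ)
          = ((∫ x : ℝ, Complex.exp (t * x * Complex.I) * f x)
            - ∫ x : ℝ, Complex.exp (t * x * Complex.I) * starRingEnd ℂ (f x))
              / (2 * Complex.I) := by
        rw [← integral_sub (hint t) (hint' t), ← integral_div]
        congr 1 with x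
        rw [Complex.im_eq_sub_conj]
        ring
      simp only [Function.comp]
      rw [this, Complex.im_eq_sub_conj, charFun_zero_measure]
      linear_combination (h t - hconj t) / (2 * Complex.I)) hS h0
  apply Complex.ext
  · rw [Complex.ofReal_re, hre]
    exact integral_re hf.integrableOn
  · rw [Complex.ofReal_im, ← RCLike.im_to_complex, ← integral_im hf.integrableOn]
    simpa using him

/-- Partial fraction expansion over a denominator with simple roots. -/
lemma exists_eval_div_eq_add_sum_div {K : ℕ} (D p : ℂ[X]) (hD0 : D ≠ 0)
    (hDdeg : D.natDegree = K) (r : Fin K → ℂ) (hr : Function.Injective r)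
    (hroot : ∀ i, D.eval (r i) = 0) :
    ∃ (q : ℂ[X]) (a : Fin K → ℂ),
      (∀ s, D.eval s ≠ 0 → p.eval s / D.eval s = q.eval s + ∑ i, a i / (s - r i)) ∧
      ∀ i, p.eval (r i) = 0 → a i = 0 := by
  obtain ⟨E, hE⟩ : ∏ i, (X - C (r i)) ∣ D :=
    Finset.prod_dvd_of_coprime (fun i _ j _ hij => pairwise_coprime_X_sub_C hr hij)
      fun i _ => dvd_iff_isRoot.2 (hroot i)
  have hE0 : E ≠ 0 := by rintro rfl; simp_all
  have hprod0 : ∏ i, (X - C (r i)) ≠ 0 := by intro h; simp_all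
  have hEdeg : E.natDegree = 0 := by
    have := congrArg natDegree hE
    rw [natDegree_mul hprod0 hE0, natDegree_finsetProd_X_sub_C_eq_card, hDdeg] at this
    simpa using this
  obtain ⟨e, rfl⟩ := natDegree_eq_zero.1 hEdeg
  have he : e ≠ 0 := by rintro rfl; simp at hE0
  obtain ⟨q, ρ, hρ, hp⟩ := eq_quo_mul_prod_add_sum_rem_mul_prod (s := Finset.univ) p
    (g := fun i => X - C (r i)) (fun i _ => monic_X_sub_C _)
    (fun i _ j _ hij => pairwise_coprime_X_sub_C hr hij)
  have hρC (i) : ρ i = C ((ρ i).coeff 0) :=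
    eq_C_of_degree_le_zero (by
      have := hρ i (Finset.mem_univ i)
      rw [degree_X_sub_C] at this
      exact Nat.WithBot.lt_one_iff_le_zero.1 this)
  have hev (s : ℂ) : p.eval s = q.eval s * ∏ i, (s - r i)
      + ∑ i, (ρ i).coeff 0 * ∏ k ∈ Finset.univ.erase i, (s - r k) := by
    conv_lhs => rw [hp]
    simp only [eval_add, eval_mul, eval_prod, eval_finsetSum, eval_sub, eval_X, eval_C]
    congr 1
    refine Finset.sum_congr rfl fun i _ => ?_
    congr 1
    rw [hρC i]; simp
  have hDev (s : ℂ) : D.eval s = (∏ i, (s - r i)) * e := by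
    rw [hE]; simp [eval_prod]
  refine ⟨C e⁻¹ * q, fun i => e⁻¹ * (ρ i).coeff 0, fun s hs => ?_, fun i hi => ?_⟩
  · rw [hDev] at hs
    have hs' := left_ne_zero_of_mul hs
    rw [hDev, hev, div_eq_iff hs, add_mul, Finset.sum_mul, eval_mul, eval_C]
    congr 1
    · field_simp
    · refine Finset.sum_congr rfl fun i _ => ?_
      have := Finset.prod_ne_zero_iff.1 hs' i (Finset.mem_univ i)
      rw [← Finset.mul_prod_erase _ _ (Finset.mem_univ i)]
      field_simp
  · rw [hev, Finset.prod_eq_zero (Finset.mem_univ i) (sub_self _), mul_zero, zero_add,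
      Finset.sum_eq_single i] at hi
    · have : ∏ k ∈ Finset.univ.erase i, (r i - r k) ≠ 0 :=
        Finset.prod_ne_zero_iff.2 fun k hk =>
          sub_ne_zero.2 fun h => (Finset.mem_erase.1 hk).1 (hr h.symm)
      simp [(mul_eq_zero.1 hi).resolve_right this]
    · intro j _ hj
      rw [Finset.prod_eq_zero (Finset.mem_erase.2 ⟨hj.symm, Finset.mem_univ i⟩) (sub_self _),
        mul_zero]
    · simp

lemma dense_setOf_eval_neg_mul_I_ne_zero {p : ℂ[X]} (hp : p ≠ 0) :
    Dense {t : ℝ | p.eval (-(t * Complex.I)) ≠ 0} := by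
  have hinj : Function.Injective fun t : ℝ => -(t * Complex.I) := fun s t hst => by
    simpa using hst
  have hfin : {t : ℝ | p.eval (-(t * Complex.I)) = 0}.Finite :=
    ((p.rootSet_finite ℂ).preimage hinj.injOn).subset fun t ht => by
      simpa [mem_rootSet, hp] using! ht
  exact hfin.countable.dense_compl ℝ

/-- A bounded continuous function on the imaginary axis that is a quotient of polynomials, the
denominator having simple roots, is a constant plus simple poles off the axis. -/
lemma exists_eq_add_sum_div_of_bounded {K : ℕ} (D p : ℂ[X]) (hD0 : D ≠ 0)
    (hDdeg : D.natDegree = K) (r : Fin K → ℂ) (hr : Function.Injective r)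
    (hroot : ∀ i, D.eval (r i) = 0) (φ : ℝ → ℂ) (hφ : Continuous φ) (hφ1 : ∀ t, ‖φ t‖ ≤ 1)
    (h : ∀ t : ℝ, φ t * D.eval (-(t * Complex.I)) = p.eval (-(t * Complex.I))) :
    ∃ (c : ℂ) (a : Fin K → ℂ), (∀ i, (r i).re = 0 → a i = 0) ∧
      ∀ t : ℝ, φ t = c + ∑ i, a i / (-(t * Complex.I) - r i) := by
  obtain ⟨q, a, hqa, ha⟩ := exists_eval_div_eq_add_sum_div D p hD0 hDdeg r hr hroot
  have ha0 (i) (hi : (r i).re = 0) : a i = 0 := by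
    refine ha i ?_
    have hri : -(((-(r i).im : ℝ) : ℂ) * Complex.I) = r i := by
      apply Complex.ext <;> simp [hi]
    have := h (-(r i).im)
    rw [hri, hroot, mul_zero] at this
    exact this.symm
  have hcont : Continuous fun t : ℝ => q.eval (-(t * Complex.I))
      + ∑ i, a i / (-(t * Complex.I) - r i) := by
    refine (q.continuous.comp (by fun_prop)).add (continuous_finsetSum _ fun i _ => ?_)
    by_cases hi : (r i).re = 0
    · simpa [ha0 i hi] using continuous_const
    · refine continuous_const.div (by fun_prop) fun t ht => hi ?_
      have := congrArg Complex.re ht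
      simpa using this
  have heq := Continuous.ext_on (dense_setOf_eval_neg_mul_I_ne_zero hD0) hφ hcont fun t ht => by
    have ht' : D.eval (-(t * Complex.I)) ≠ 0 := ht
    rw [← hqa _ ht', ← h t, mul_div_cancel_right₀ _ ht']
  have hq : q.degree ≤ 0 := by
    by_contra! hq
    have hnorm : Filter.Tendsto (fun t : ℝ => ‖-(t * Complex.I)‖) Filter.atTop Filter.atTop := by
      simpa using! Filter.tendsto_abs_atTop_atTop
    have h1 := q.tendsto_norm_atTop hq hnorm
    have h2 : Filter.Tendsto (fun t : ℝ => ∑ i, a i / (-(t * Complex.I) - r i))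
        Filter.atTop (nhds 0) := by
      rw [← Finset.sum_const_zero (s := (Finset.univ : Finset (Fin K)))]
      refine tendsto_finsetSum _ fun i _ => ?_
      rw [← mul_zero (a i)]
      simp_rw [div_eq_mul_inv]
      refine Filter.Tendsto.const_mul _ (Filter.tendsto_inv₀_cobounded.comp ?_)
      rw [← tendsto_norm_atTop_iff_cobounded]
      refine Filter.tendsto_atTop_mono (fun t => norm_sub_norm_le _ (r i)) ?_
      exact Filter.tendsto_atTop_add_const_right _ (-‖r i‖) hnorm
    have h3 : ∀ᶠ t : ℝ in Filter.atTop, ‖q.eval (-(t * Complex.I))‖ ≤ 2 := by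
      filter_upwards [h2.norm.eventually_le_const (u := 1) (by simp)] with t ht
      have : q.eval (-(t * Complex.I)) = φ t - ∑ i, a i / (-(t * Complex.I) - r i) := by
        rw [congrFun heq t]; ring
      rw [this]
      exact (norm_sub_le _ _).trans (by linarith [hφ1 t])
    obtain ⟨t, h4, h5⟩ := (h3.and (h1.eventually_gt_atTop 2)).exists
    linarith
  refine ⟨q.coeff 0, a, ha0, fun t => ?_⟩
  rw [congrFun heq t, eq_C_of_degree_le_zero hq]
  simp

/-- The integrable function whose bilateral Laplace transform on the imaginary axis is
`1 / (s - r)`, for `Re r ≠ 0`. -/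
noncomputable def poleKernel (r : ℂ) (x : ℝ) : ℂ :=
  if r.re < 0 then (Set.Ioi 0).indicator (fun x : ℝ => Complex.exp (r * x)) x
  else if 0 < r.re then (Set.Iic 0).indicator (fun x : ℝ => -Complex.exp (r * x)) x
  else 0

lemma measurable_poleKernel (r : ℂ) : Measurable (poleKernel r) := by
  unfold poleKernel
  split_ifs
  · exact Measurable.indicator (by fun_prop) measurableSet_Ioi
  · exact Measurable.indicator (by fun_prop) measurableSet_Iic
  · exact measurable_const

lemma integrable_poleKernel (r : ℂ) : Integrable (poleKernel r) := by
  unfold poleKernel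
  split_ifs with h h'
  · exact (integrableOn_exp_mul_complex_Ioi h 0).integrable_indicator measurableSet_Ioi
  · exact (integrableOn_exp_mul_complex_Iic h' 0).neg.integrable_indicator measurableSet_Iic
  · exact integrable_zero _ _ _

lemma integral_exp_mul_poleKernel {r : ℂ} (hr : r.re ≠ 0) (t : ℝ) :
    ∫ x : ℝ, Complex.exp (t * x * Complex.I) * poleKernel r x = 1 / (-(t * Complex.I) - r) := by
  have hre : (t * Complex.I + r).re = r.re := by simp
  have hexp (x : ℝ) : Complex.exp (t * x * Complex.I) * Complex.exp (r * x)
      = Complex.exp ((t * Complex.I + r) * x) := by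
    rw [← Complex.exp_add]; ring_nf
  have hne : t * Complex.I + r ≠ 0 := fun h => hr (by rw [← hre, h, Complex.zero_re])
  have hne' : -(t * Complex.I) - r ≠ 0 := fun h => hne (by linear_combination -h)
  rcases lt_or_gt_of_ne hr with h | h
  · have : (fun x : ℝ => Complex.exp (t * x * Complex.I) * poleKernel r x)
        = (Set.Ioi 0).indicator fun x : ℝ => Complex.exp ((t * Complex.I + r) * x) := by
      ext x
      simp only [poleKernel, h, if_true, Set.indicator_apply]
      split_ifs <;> simp [hexp]
    rw [this, integral_indicator measurableSet_Ioi,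
      integral_exp_mul_complex_Ioi (by rwa [hre])]
    simp only [Complex.ofReal_zero, mul_zero, Complex.exp_zero]
    field_simp
    ring
  · have : (fun x : ℝ => Complex.exp (t * x * Complex.I) * poleKernel r x)
        = (Set.Iic 0).indicator fun x : ℝ => -Complex.exp ((t * Complex.I + r) * x) := by
      ext x
      simp only [poleKernel, h, h.not_gt, if_true, if_false, Set.indicator_apply]
      split_ifs <;> simp [hexp]
    rw [this, integral_indicator measurableSet_Iic, integral_neg,
      integral_exp_mul_complex_Iic (by rwa [hre])]
    simp only [Complex.ofReal_zero, mul_zero, Complex.exp_zero]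
    field_simp
    ring

lemma map_eq_expMeasure {Ω : Type*} [MeasurableSpace Ω] (Pr : Measure Ω) [IsProbabilityMeasure Pr]
    {lam : ℝ} (hlam : 0 < lam) {A : Ω → ℝ} (hA : Measurable A)
    (hA_exp : ∀ x : ℝ, Pr {ω | A ω ≤ x} = ENNReal.ofReal (1 - Real.exp (-lam * x))) :
    Pr.map A = expMeasure lam := by
  have := isProbabilityMeasure_expMeasure hlam
  have := Measure.isProbabilityMeasure_map (μ := Pr) hA.aemeasurable
  refine Measure.eq_of_cdf _ _ ?_
  ext x
  rw [cdf_expMeasure_eq hlam, cdf_eq_real, measureReal_def, Measure.map_apply hA measurableSet_Iic]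
  change (Pr {ω | A ω ≤ x}).toReal = _
  rw [hA_exp, ENNReal.toReal_ofReal', neg_mul]
  split_ifs with h
  · refine max_eq_left (sub_nonneg.2 (Real.exp_le_one_iff.2 ?_))
    nlinarith
  · refine max_eq_right (sub_nonpos.2 (Real.one_le_exp ?_))
    nlinarith

lemma expMeasure_eq_withDensity {lam : ℝ} :
    expMeasure lam = (volume.restrict (Set.Ioi 0)).withDensity
      fun x => ENNReal.ofReal (lam * Real.exp (-lam * x)) := by
  rw [← withDensity_indicator measurableSet_Ioi]
  refine withDensity_congr_ae ?_
  filter_upwards [Measure.ae_ne volume (0 : ℝ)] with x hx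
  change exponentialPDF lam x = _
  rw [exponentialPDF_eq, Set.indicator_apply]
  rcases lt_or_gt_of_ne hx with h | h
  · simp [h.not_ge, h.not_gt]
  · simp [h.le, h]

lemma integrable_cexp_expMeasure {lam : ℝ} (hlam : 0 < lam) {z : ℂ}
    (h : Integrable (fun x : ℝ => Complex.exp (z * x)) (expMeasure lam)) : z.re < lam := by
  rw [expMeasure_eq_withDensity, integrable_withDensity_iff_integrable_smul' (by fun_prop)
    (by simp)] at h
  by_contra! hz
  have h1 : IntegrableOn (fun _ : ℝ => lam) (Set.Ioi 0) := by
    refine h.mono (by fun_prop) ?_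
    filter_upwards [ae_restrict_mem measurableSet_Ioi] with x hx
    have hx : 0 < x := hx
    rw [norm_smul, Complex.norm_exp, ENNReal.toReal_ofReal (by positivity), Real.norm_eq_abs,
      Real.norm_eq_abs, abs_of_pos hlam, abs_of_pos (by positivity), mul_assoc, ← Real.exp_add]
    refine le_mul_of_one_le_right hlam.le (Real.one_le_exp ?_)
    simp only [Complex.mul_re, Complex.ofReal_re, Complex.ofReal_im, mul_zero, sub_zero]
    nlinarith
  simp [integrableOn_const_iff, hlam.ne'] at h1

lemma integral_cexp_expMeasure {lam : ℝ} (hlam : 0 < lam) {z : ℂ} (hz : z.re < lam) :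
    ∫ x : ℝ, Complex.exp (z * x) ∂(expMeasure lam) = lam / (lam - z) := by
  rw [expMeasure_eq_withDensity, integral_withDensity_eq_integral_toReal_smul (by fun_prop)
    (by simp)]
  have (x : ℝ) : (ENNReal.ofReal (lam * Real.exp (-lam * x))).toReal • Complex.exp (z * x)
      = lam * Complex.exp ((z - lam) * x) := by
    rw [ENNReal.toReal_ofReal (by positivity), Complex.real_smul]
    push_cast
    rw [mul_assoc, ← Complex.exp_add]
    ring_nf
  simp_rw [this]
  rw [integral_const_mul, integral_exp_mul_complex_Ioi (by simpa using hz)]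
  simp only [Complex.ofReal_zero, mul_zero, Complex.exp_zero]
  rw [← neg_sub (lam : ℂ) z, neg_div_neg_eq, mul_one_div]

/-- The characteristic function of `B - A`, cleared of denominators. -/
lemma charFun_map_sub_mul_eval {Ω : Type*} [MeasurableSpace Ω] (Pr : Measure Ω)
    [IsProbabilityMeasure Pr] {lam : ℝ} (hlam : 0 < lam) {A B : Ω → ℝ} (hA : Measurable A)
    (hB : Measurable B)
    (hA_exp : ∀ x : ℝ, Pr {ω | A ω ≤ x} = ENNReal.ofReal (1 - Real.exp (-lam * x)))
    {P₁ Q₁ P₂ Q₂ : ℂ[X]} (hQ₁ : Q₁ ≠ 0) (hQ₂ : Q₂ ≠ 0)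
    (h_cond : ∀ s : ℂ, 0 ≤ s.re → Q₁.eval s ≠ 0 → Q₂.eval s ≠ 0 →
      Integrable (fun ω => Complex.exp (-s * B ω)) Pr ∧
        (Pr[fun ω => Complex.exp (-s * B ω) | MeasurableSpace.comap A inferInstance]
          =ᵐ[Pr] fun ω =>
            (P₁.eval s / Q₁.eval s) * Complex.exp (-(P₂.eval s / Q₂.eval s) * A ω)))
    (t : ℝ) :
    charFun (Pr.map fun ω => B ω - A ω) t
        * (Q₁ * ((C (lam : ℂ) - X) * Q₂ + P₂)).eval (-(t * Complex.I))
      = (C (lam : ℂ) * P₁ * Q₂).eval (-(t * Complex.I)) := by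
  have hX : Measurable fun ω => B ω - A ω := hB.sub hA
  have := Measure.isProbabilityMeasure_map (μ := Pr) hX.aemeasurable
  have hc (p : ℂ[X]) : Continuous fun t : ℝ => p.eval (-(t * Complex.I)) :=
    p.continuous.comp (by fun_prop)
  refine congrFun (Continuous.ext_on (dense_setOf_eval_neg_mul_I_ne_zero (mul_ne_zero hQ₁ hQ₂))
    (continuous_charFun.mul (hc _)) (hc _) fun t ht => ?_) t
  replace ht : (Q₁ * Q₂).eval (-(t * Complex.I)) ≠ 0 := ht
  simp only [Pi.mul_apply]
  obtain ⟨s, hs⟩ : ∃ s : ℂ, s = -(t * Complex.I) := ⟨_, rfl⟩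
  have hsre : s.re = 0 := by simp [hs]
  rw [← hs] at ht ⊢
  rw [eval_mul] at ht
  have hq1 := left_ne_zero_of_mul ht
  have hq2 := right_ne_zero_of_mul ht
  obtain ⟨hint, hce⟩ := h_cond s hsre.ge hq1 hq2
  set χ := P₁.eval s / Q₁.eval s with hχ
  set ψ := P₂.eval s / Q₂.eval s with hψ
  have hm : MeasurableSpace.comap A inferInstance ≤ (inferInstance : MeasurableSpace Ω) :=
    hA.comap_le
  have hchar : charFun (Pr.map fun ω => B ω - A ω) t
      = χ * ∫ ω, Complex.exp ((s - ψ) * A ω) ∂Pr := by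
    have hnorm (ω : Ω) : ‖Complex.exp (s * A ω)‖ = 1 := by simp [Complex.norm_exp, hsre]
    have hfm : StronglyMeasurable[MeasurableSpace.comap A inferInstance]
        fun ω => Complex.exp (s * A ω) :=
      ((show Measurable fun x : ℝ => Complex.exp (s * x) by fun_prop).comp
        (comap_measurable A)).stronglyMeasurable
    have hpull := condExp_bilin_of_stronglyMeasurable_left (μ := Pr)
      (ContinuousLinearMap.mul ℝ ℂ) hfm
      (g := fun ω => Complex.exp (-s * B ω))
      (hint.bdd_mul (c := 1) (by fun_prop) (.of_forall fun ω => (hnorm ω).le)) hint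
    simp only [ContinuousLinearMap.mul_apply'] at hpull
    rw [charFun_apply_real, integral_map hX.aemeasurable (by fun_prop),
      ← integral_const_mul]
    calc _ = ∫ ω, Complex.exp (s * A ω) * Complex.exp (-s * B ω) ∂Pr := by
          congr 1 with ω
          rw [← Complex.exp_add, hs]
          push_cast
          ring_nf
      _ = ∫ ω, (Pr[fun ω => Complex.exp (s * A ω) * Complex.exp (-s * B ω) |
            MeasurableSpace.comap A inferInstance]) ω ∂Pr := (integral_condExp hm).symm
      _ = _ := by
          refine integral_congr_ae ?_
          filter_upwards [hpull, hce] with ω h1 h2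
          rw [h1, h2, mul_left_comm, ← Complex.exp_add]
          ring_nf
  rw [hchar]
  simp only [eval_mul, eval_add, eval_sub, eval_C, eval_X]
  by_cases hp1 : P₁.eval s = 0
  · simp [hχ, hp1]
  have hχ0 : χ ≠ 0 := div_ne_zero hp1 hq1
  have hmap := map_eq_expMeasure Pr hlam hA hA_exp
  have hψre : (-ψ).re < lam := by
    refine integrable_cexp_expMeasure hlam ?_
    rw [← hmap, integrable_map_measure (by fun_prop) hA.aemeasurable]
    have h1 := ((integrable_condExp (μ := Pr)).congr hce).const_mul χ⁻¹
    refine h1.congr (.of_forall fun ω => ?_)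
    simp only [Function.comp]
    rw [inv_mul_cancel_left₀ hχ0]
  have hre : (s - ψ).re < lam := by simpa [hsre] using hψre
  have hE : ∫ ω, Complex.exp ((s - ψ) * A ω) ∂Pr = lam / (lam - (s - ψ)) := by
    rw [← integral_cexp_expMeasure hlam hre, ← hmap,
      integral_map hA.aemeasurable (by fun_prop)]
  have hne : (lam : ℂ) - (s - ψ) ≠ 0 := fun h => by
    have := congrArg Complex.re h
    rw [Complex.sub_re, Complex.ofReal_re, Complex.zero_re] at this
    linarith
  have hP₁ : P₁.eval s = χ * Q₁.eval s := by rw [hχ, div_mul_cancel₀ _ hq1]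
  have hP₂ : P₂.eval s = ψ * Q₂.eval s := by rw [hψ, div_mul_cancel₀ _ hq2]
  rw [hE, hP₁, hP₂]
  field_simp
  ring

/-- On `(0, ∞)`, a distribution with rational characteristic function whose poles are simple has
an exponential-polynomial density. -/
lemma exists_measureReal_eq_setIntegral_of_charFun {K : ℕ} (μ : Measure ℝ)
    [IsProbabilityMeasure μ] (D p : ℂ[X]) (hD0 : D ≠ 0) (hDdeg : D.natDegree = K)
    (r : Fin K → ℂ) (hr : Function.Injective r) (hroot : ∀ i, D.eval (r i) = 0)
    (h : ∀ t : ℝ, charFun μ t * D.eval (-(t * Complex.I)) = p.eval (-(t * Complex.I))) :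
    ∃ a : Fin K → ℂ, (∀ i, 0 ≤ (r i).re → a i = 0) ∧ ∀ S : Set ℝ, MeasurableSet S →
      S ⊆ Set.Ioi 0 → (μ.real S : ℂ) = ∫ x in S, ∑ i, a i * Complex.exp (r i * x) := by
  obtain ⟨c, a, ha, hφ⟩ := exists_eq_add_sum_div_of_bounded D p hD0 hDdeg r hr hroot (charFun μ)
    continuous_charFun norm_charFun_le_one h
  refine ⟨fun i => if (r i).re < 0 then a i else 0, fun i hi => if_neg hi.not_gt,
    fun S hS hS0 => ?_⟩
  rw [measureReal_eq_setIntegral_of_charFun μ c (f := fun x => ∑ i, a i * poleKernel (r i) x)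
    (Finset.measurable_fun_sum _ fun i _ => (measurable_poleKernel _).const_mul _)
    (integrable_finsetSum _ fun i _ => (integrable_poleKernel _).const_mul _) ?_ hS
    fun h0 => lt_irrefl (0 : ℝ) (hS0 h0)]
  · refine setIntegral_congr_fun hS fun x hx => Finset.sum_congr rfl fun i _ => ?_
    have hx0 : x ∈ Set.Ioi 0 := hS0 hx
    have hx1 : x ∉ Set.Iic 0 := fun h => lt_irrefl (0 : ℝ) (lt_of_lt_of_le hx0 h)
    simp only [poleKernel, Set.indicator_of_mem hx0, Set.indicator_of_notMem hx1]
    split_ifs <;> simp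
  · intro t
    rw [hφ t]
    congr 1
    simp_rw [Finset.mul_sum, mul_left_comm _ (a _) _]
    rw [integral_finsetSum _ fun i _ =>
      (Integrable.exp_mul_I_mul (integrable_poleKernel (r i)) t).const_mul (a i)]
    refine Finset.sum_congr rfl fun i _ => ?_
    rw [integral_const_mul]
    by_cases hi : (r i).re = 0
    · simp [ha i hi]
    · rw [integral_exp_mul_poleKernel hi, mul_one_div]

/-- Subtracting an independent nonnegative variable preserves the form of an
exponential-polynomial density on `(0, ∞)`. -/
lemma measureReal_prod_sub_eq_setIntegral {K : ℕ} (μ ν : Measure ℝ) [IsProbabilityMeasure μ]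
    [IsProbabilityMeasure ν] (hν : ∀ᵐ w ∂ν, 0 ≤ w) (r a : Fin K → ℂ)
    (ha : ∀ i, 0 ≤ (r i).re → a i = 0)
    (hμ : ∀ S : Set ℝ, MeasurableSet S → S ⊆ Set.Ioi 0 →
      (μ.real S : ℂ) = ∫ x in S, ∑ i, a i * Complex.exp (r i * x))
    {S : Set ℝ} (hS : MeasurableSet S) (hS0 : S ⊆ Set.Ioi 0) :
    ((ν.prod μ).real {p | p.2 - p.1 ∈ S} : ℂ)
      = ∫ x in S, ∑ i, (a i * ∫ w : ℝ, Complex.exp (r i * w) ∂ν) * Complex.exp (r i * x) := by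
  have hint (i : Fin K) (b : ℂ) :
      IntegrableOn (fun x : ℝ => (a i * b) * Complex.exp (r i * x)) S := by
    rcases lt_or_ge (r i).re 0 with hi | hi
    · exact ((integrableOn_exp_mul_complex_Ioi hi 0).mono_set hS0).const_mul _
    · simp [ha i hi]
  have hmeas : MeasurableSet {p : ℝ × ℝ | p.2 - p.1 ∈ S} :=
    (measurable_snd.sub measurable_fst) hS
  have hprod : (ν.prod μ).real {p | p.2 - p.1 ∈ S}
      = ∫ w, μ.real ((fun x => x - w) ⁻¹' S) ∂ν := by
    rw [measureReal_def, Measure.prod_apply hmeas, ← integral_toReal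
      (measurable_measure_prodMk_left hmeas).aemeasurable (.of_forall fun w => measure_lt_top _ _)]
    rfl
  have hsec : ∀ᵐ w ∂ν, (μ.real ((fun x => x - w) ⁻¹' S) : ℂ)
      = ∑ i, (a i * Complex.exp (r i * w)) * ∫ x in S, Complex.exp (r i * x) := by
    filter_upwards [hν] with w hw
    rw [hμ _ ((measurable_sub_const w) hS) fun x hx => by
      have : 0 < x - w := hS0 hx
      exact Set.mem_Ioi.2 (by linarith)]
    have := (measurePreserving_sub_right volume w).setIntegral_preimage_emb
      (measurableEmbedding_subRight w)
      (fun y : ℝ => ∑ i, a i * Complex.exp (r i * (y + w : ℝ))) S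
    simp only [sub_add_cancel] at this
    rw [this]
    simp_rw [← integral_const_mul]
    rw [← integral_finsetSum _ fun i _ => hint i _]
    congr 1 with x
    refine Finset.sum_congr rfl fun i _ => ?_
    rw [mul_assoc, ← Complex.exp_add]
    push_cast
    ring_nf
  rw [hprod, ← integral_complex_ofReal, integral_congr_ae hsec, integral_finsetSum,
    integral_finsetSum _ fun i _ => hint i _]
  · refine Finset.sum_congr rfl fun i _ => ?_
    rw [integral_mul_const, integral_const_mul, integral_const_mul]
  · intro i _
    refine Integrable.mul_const ?_ _
    rcases lt_or_ge (r i).re 0 with hi | hi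
    · refine Integrable.const_mul (Integrable.of_bound (C := 1) (by fun_prop) ?_) _
      filter_upwards [hν] with w hw
      rw [Complex.norm_exp]
      refine Real.exp_le_one_iff.2 ?_
      simp only [Complex.mul_re, Complex.ofReal_re, Complex.ofReal_im, mul_zero, sub_zero]
      nlinarith
    · simp [ha i hi]

/-- A continuous function all of whose integrals over subsets of `(0, ∞)` are real is real. -/
lemma im_eq_zero_of_setIntegral {f : ℝ → ℂ} (hf : Continuous f)
    (hfi : IntegrableOn f (Set.Ioi 0))
    (h : ∀ S : Set ℝ, MeasurableSet S → S ⊆ Set.Ioi 0 → (∫ x in S, f x).im = 0)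
    {x : ℝ} (hx : 0 < x) : (f x).im = 0 := by
  have hae : (fun x => (f x).im) =ᵐ[volume.restrict (Set.Ioi 0)] fun _ => 0 := by
    refine Integrable.ae_eq_zero_of_forall_setIntegral_eq_zero hfi.im fun S hS _ => ?_
    rw [Measure.restrict_restrict hS]
    have := h (S ∩ Set.Ioi 0) (hS.inter measurableSet_Ioi) Set.inter_subset_right
    rw [← RCLike.im_to_complex, ← integral_im (hfi.mono_set Set.inter_subset_right)] at this
    exact this
  exact Measure.eqOn_open_of_ae_eq hae isOpen_Ioi (Complex.continuous_im.comp hf).continuousOn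
    continuousOn_const hx

/-- Alternating service model where the preparation time depends on the previous service
time: `A ~ Exp(λ)`, `E[e^{-sB} | A] = χ(s) e^{-ψ(s) A}` with `χ = P₁/Q₁`, `ψ = P₂/Q₂`
rational (`deg P₂ = L`, `deg Q₁ = M`, `deg Q₂ = N`, `χ(0) = 1`, `ψ(0) = 0`), `W ≥ 0`
independent of `(A, B)` and stationary for the recursion. If
`D(s) = Q₁(s)((λ - s)Q₂(s) + P₂(s))` has degree `K = max (M+N+1) (M+L)` and `K` distinct
zeros `r₁, …, r_K`, then `P[W = 0] = c₀` for some `c₀ ∈ [0,1]` and the law of `W` on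
`(0,∞)` has density `x ↦ ∑ᵢ cᵢ e^{rᵢ x}` (real-valued there), where `cᵢ = 0` whenever
`Re rᵢ ≥ 0`. -/
theorem stmt3 {Ω : Type*} [MeasurableSpace Ω] (Pr : Measure Ω) [IsProbabilityMeasure Pr]
    (lam : ℝ) (hlam : 0 < lam)
    (A B W : Ω → ℝ) (hA : Measurable A) (hB : Measurable B) (hW : Measurable W)
    (hW_nonneg : ∀ ω, 0 ≤ W ω)
    (hA_exp : ∀ x : ℝ, Pr {ω | A ω ≤ x} = ENNReal.ofReal (1 - Real.exp (-lam * x)))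
    (P₁ Q₁ P₂ Q₂ : Polynomial ℂ) (L M N : ℕ)
    (hdegP₂ : P₂.natDegree = L) (hdegQ₁ : Q₁.natDegree = M) (hdegQ₂ : Q₂.natDegree = N)
    (hQ₁0 : Q₁.eval 0 ≠ 0) (hQ₂0 : Q₂.eval 0 ≠ 0)
    (hχ0 : P₁.eval 0 / Q₁.eval 0 = 1) (hψ0 : P₂.eval 0 / Q₂.eval 0 = 0)
    -- The conditional Laplace–Stieltjes transform of `B` given `A` is
    -- `χ(s) e^{-ψ(s) t}`, for all `s` with `Re s ≥ 0` at which `χ` and `ψ` have no poles.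
    (h_cond : ∀ s : ℂ, 0 ≤ s.re → Q₁.eval s ≠ 0 → Q₂.eval s ≠ 0 →
      Integrable (fun ω => Complex.exp (-s * B ω)) Pr ∧
        (Pr[fun ω => Complex.exp (-s * B ω) | MeasurableSpace.comap A inferInstance]
          =ᵐ[Pr] fun ω =>
            (P₁.eval s / Q₁.eval s) * Complex.exp (-(P₂.eval s / Q₂.eval s) * A ω)))
    (h_indep : IndepFun W (fun ω => (A ω, B ω)) Pr)
    (h_stat : Measure.map (fun ω => max 0 (B ω - A ω - W ω)) Pr = Measure.map W Pr)
    (K : ℕ) (hK : K = max (M + N + 1) (M + L))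
    (D : Polynomial ℂ)
    (hD : D = Q₁ * ((Polynomial.C (lam : ℂ) - Polynomial.X) * Q₂ + P₂))
    (hDdeg : D.natDegree = K)
    (r : Fin K → ℂ) (hr_inj : Function.Injective r) (hr_root : ∀ i, D.eval (r i) = 0) :
    ∃ (c₀ : ℝ) (c : Fin K → ℂ),
      c₀ ∈ Set.Icc (0 : ℝ) 1
        ∧ (∀ i, 0 ≤ (r i).re → c i = 0)
        ∧ Pr {ω | W ω = 0} = ENNReal.ofReal c₀
        ∧ (∀ x : ℝ, 0 < x → (∑ i, c i * Complex.exp (r i * x)).im = 0)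
        ∧ ∀ S : Set ℝ, MeasurableSet S → S ⊆ Set.Ioi 0 →
            Pr {ω | W ω ∈ S}
              = ENNReal.ofReal (∫ x in S, (∑ i, c i * Complex.exp (r i * x)).re) := by
  have hX : Measurable fun ω => B ω - A ω := hB.sub hA
  have := Measure.isProbabilityMeasure_map (μ := Pr) hX.aemeasurable
  have := Measure.isProbabilityMeasure_map (μ := Pr) hW.aemeasurable
  have hD0 : D ≠ 0 := by
    rintro rfl
    rw [natDegree_zero] at hDdeg
    have : M + N + 1 ≤ K := hK ▸ le_max_left _ _
    omega
  have hQ₁ : Q₁ ≠ 0 := fun h => hQ₁0 (by simp [h])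
  have hQ₂ : Q₂ ≠ 0 := fun h => hQ₂0 (by simp [h])
  obtain ⟨a, ha, hμ⟩ := exists_measureReal_eq_setIntegral_of_charFun
    (Pr.map fun ω => B ω - A ω) D (C (lam : ℂ) * P₁ * Q₂) hD0 hDdeg r hr_inj hr_root
    (by rw [hD]; exact charFun_map_sub_mul_eval Pr hlam hA hB hA_exp hQ₁ hQ₂ h_cond)
  have hν : ∀ᵐ w ∂(Pr.map W), 0 ≤ w :=
    (ae_map_iff hW.aemeasurable measurableSet_Ici).2 (.of_forall hW_nonneg)
  have hprod : Pr.map (fun ω => (W ω, B ω - A ω))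
      = (Pr.map W).prod (Pr.map fun ω => B ω - A ω) :=
    (indepFun_iff_map_prod_eq_prod_map_map hW.aemeasurable hX.aemeasurable).1
      (h_indep.comp measurable_id (measurable_snd.sub measurable_fst))
  have hlaw (S : Set ℝ) (hS : MeasurableSet S) (hS0 : S ⊆ Set.Ioi 0) :
      (Pr.real {ω | W ω ∈ S} : ℂ) = ∫ x in S,
        ∑ i, (a i * ∫ w : ℝ, Complex.exp (r i * w) ∂(Pr.map W)) * Complex.exp (r i * x) := by
    have hmeas : MeasurableSet {p : ℝ × ℝ | p.2 - p.1 ∈ S} :=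
      (measurable_snd.sub measurable_fst) hS
    rw [← measureReal_prod_sub_eq_setIntegral (Pr.map fun ω => B ω - A ω) (Pr.map W) hν r a ha hμ
      hS hS0, ← hprod, map_measureReal_apply (hW.prodMk hX) hmeas]
    have hmax := congrArg (fun κ : Measure ℝ => κ.real S) h_stat
    beta_reduce at hmax
    have hR : Measurable fun ω => max 0 (B ω - A ω - W ω) := measurable_const.max (hX.sub hW)
    rw [map_measureReal_apply hR hS,
      map_measureReal_apply hW hS] at hmax
    change ((Pr.real (W ⁻¹' S) : ℝ) : ℂ) = _
    rw [← hmax]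
    congr 2
    ext ω
    simp only [Set.mem_preimage, Set.mem_ofPred_eq]
    rcases le_total (B ω - A ω - W ω) 0 with h | h
    · rw [max_eq_left h]
      exact iff_of_false (fun h0 => lt_irrefl (0 : ℝ) (hS0 h0)) fun h0 => h.not_gt (hS0 h0)
    · rw [max_eq_right h]
  have hint : IntegrableOn (fun x : ℝ => ∑ i, (a i * ∫ w : ℝ, Complex.exp (r i * w) ∂(Pr.map W))
      * Complex.exp (r i * x)) (Set.Ioi 0) := by
    refine integrable_finsetSum _ fun i _ => ?_
    rcases lt_or_ge (r i).re 0 with hi | hi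
    · exact (integrableOn_exp_mul_complex_Ioi hi 0).const_mul _
    · simp [ha i hi]
  refine ⟨Pr.real {ω | W ω = 0},
    fun i => a i * ∫ w : ℝ, Complex.exp (r i * w) ∂(Pr.map W),
    ⟨measureReal_nonneg, measureReal_le_one⟩, fun i hi => by simp [ha i hi],
    (ofReal_measureReal).symm, fun x hx => ?_, fun S hS hS0 => ?_⟩
  · refine im_eq_zero_of_setIntegral (f := fun x : ℝ => ∑ i,
      (a i * ∫ w : ℝ, Complex.exp (r i * w) ∂(Pr.map W)) * Complex.exp (r i * x))
      (by fun_prop) hint (fun S hS hS0 => ?_) hx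
    rw [← hlaw S hS hS0, Complex.ofReal_im]
  · have hre := congrArg Complex.re (hlaw S hS hS0)
    rw [Complex.ofReal_re, ← RCLike.re_to_complex, ← integral_re (hint.mono_set hS0)] at hre
    rw [← ofReal_measureReal, hre]
    rfl
end
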